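/- arXiv:2007.15772 — 3 statements merged into one kernel-verified Lean document; each statement's English description precedes it below -/
import Mathlib

section
/- Let R be a local Cohen-Macaulay ring and E a finite R-module with rank e and projective dimension at most 1. Then E satisfies condition F_1 if and only if E is of linear type, i.e., the natural surjection S(E) → R(E) is an isomorphism (equivalently all symmetric powers of E are torsion-free). -/
noncomputable section

/-- The minimal number of generators of an `R`-module `M`. -/
def minGens (R M : Type) [Semiring R] [AddCommMonoid M] [Module R M] : ℕ :=
  sInf {n | ∃ s : Finset M, s.card = n ∧ Submodule.span R (s : Set M) = ⊤}

/-- The height of an ideal: the infimum of the heights of the primes containing it. -/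
def idealHeight {R : Type} [CommRing R] (I : Ideal R) : ℕ∞ :=
  ⨅ (p : PrimeSpectrum R) (_ : I ≤ p.asIdeal), Order.height p

/-- The ideal of `t × t` minors of a matrix. -/
def minorsIdeal {R : Type} [CommRing R] {n m : Type} [Fintype n] [Fintype m]
    (M : Matrix n m R) (t : ℕ) : Ideal R :=
  Ideal.span { x | ∃ (f : Fin t → n) (g : Fin t → m), x = (M.submatrix f g).det }

/-- A module `M` has rank `e` if it is free of rank `e` locally at every associated
prime of `R`. -/
def hasRank (R M : Type) [CommRing R] [AddCommGroup M] [Module R M] (e : ℕ) : Prop :=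
  ∀ (p : Ideal R) (hp : p.IsPrime), p ∈ associatedPrimes R R →
    letI := hp
    Module.Free (Localization.AtPrime p) (LocalizedModule p.primeCompl M) ∧
      Module.finrank (Localization.AtPrime p) (LocalizedModule p.primeCompl M) = e

/-- A Noetherian local ring is Cohen-Macaulay if its maximal ideal contains a regular
sequence whose length equals its Krull dimension. -/
def IsCohenMacaulayLocalRing (A : Type) [CommRing A] [IsLocalRing A] : Prop :=
  ∃ rs : List A, (∀ r ∈ rs, r ∈ IsLocalRing.maximalIdeal A) ∧
    RingTheory.Sequence.IsRegular A rs ∧ (rs.length : WithBot ℕ∞) = ringKrullDim A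

/-- A ring is Cohen-Macaulay if all its localizations at primes are Cohen-Macaulay
local rings. -/
def IsCohenMacaulayRing (A : Type) [CommRing A] : Prop :=
  ∀ (p : Ideal A) (hp : p.IsPrime),
    letI := hp
    IsCohenMacaulayLocalRing (Localization.AtPrime p)

/-- The defining relations of the symmetric algebra of a module, inside the polynomial
ring on the underlying set of the module. -/
def symRels (R M : Type) [CommRing R] [AddCommGroup M] [Module R M] :
    Set (MvPolynomial M R) :=
  {p | ∃ x y : M, p = MvPolynomial.X (x + y) - MvPolynomial.X x - MvPolynomial.X y} ∪
    {p | ∃ (r : R) (x : M), p = MvPolynomial.X (r • x) - MvPolynomial.C r * MvPolynomial.X x}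

/-- The symmetric algebra of an `R`-module `M`. -/
abbrev SymmAlgebra (R M : Type) [CommRing R] [AddCommGroup M] [Module R M] : Type :=
  MvPolynomial M R ⧸ Ideal.span (symRels R M)

section

open RingTheory.Sequence CategoryTheory Abelian Pointwise

theorem smul_top_quotSMulTop_ne_top {R M : Type*} [CommRing R] [AddCommGroup M] [Module R M]
    {I : Ideal R} {r : R} (hr : r ∈ I) (hI : I • (⊤ : Submodule R M) ≠ ⊤) :
    I • (⊤ : Submodule R (QuotSMulTop r M)) ≠ ⊤ := by
  by_contra eq
  absurd congrArg (Submodule.comap (Submodule.mkQ _)) eq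
  simpa [Submodule.comap_smul_top_of_surjective I _ (Submodule.mkQ_surjective _),
    Submodule.smul_mono_left ((Ideal.span_singleton_le_iff_mem I).mpr hr),
    ← Submodule.ideal_span_singleton_smul] using hI

theorem exists_isRegular_quotSMulTop {R M : Type} [CommRing R] [IsNoetherianRing R]
    [AddCommGroup M] [Module R M] [Module.Finite R M] {I : Ideal R}
    (hI : I • (⊤ : Submodule R M) ≠ ⊤) {x : R} (hx : x ∈ I) (hreg : IsSMulRegular M x) {n : ℕ}
    (h : ∃ rs : List R, rs.length = n + 1 ∧ (∀ r ∈ rs, r ∈ I) ∧ IsRegular M rs) :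
    ∃ rs : List R, rs.length = n ∧ (∀ r ∈ rs, r ∈ I) ∧ IsRegular (QuotSMulTop x M) rs := by
  have h1 := ((ModuleCat.exists_isRegular_tfae I (n + 1) (ModuleCat.of R M) hI.lt_top).out 3 1).mp h
  refine ((ModuleCat.exists_isRegular_tfae I n (ModuleCat.of R (QuotSMulTop x M))
    (smul_top_quotSMulTop_ne_top hx hI).lt_top).out 1 3).mp ?_
  intro i hi
  have zero1 := AddCommGrpCat.isZero_of_iff_subsingleton.mpr (h1 i (by omega))
  have zero2 := AddCommGrpCat.isZero_of_iff_subsingleton.mpr (h1 (i + 1) (by omega))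
  exact AddCommGrpCat.subsingleton_of_isZero <| ShortComplex.Exact.isZero_of_both_zeros
    ((Ext.covariant_sequence_exact₃' _
      (IsSMulRegular.smulShortComplex_shortExact (M := ModuleCat.of R M) hreg)) i (i + 1) rfl)
    (zero1.eq_zero_of_src _) (zero2.eq_zero_of_tgt _)

theorem exists_isRegular_quotient_ofList {R : Type} [CommRing R] [IsNoetherianRing R]
    {I : Ideal R} {n : ℕ} (xs : List R) (hxs : ∀ x ∈ xs, x ∈ I)
    {M : Type} [AddCommGroup M] [Module R M] [Module.Finite R M]
    (hI : I • (⊤ : Submodule R M) ≠ ⊤) (hreg : IsWeaklyRegular M xs)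
    (h : ∃ rs : List R, rs.length = n + xs.length ∧ (∀ r ∈ rs, r ∈ I) ∧ IsRegular M rs) :
    ∃ rs : List R, rs.length = n ∧ (∀ r ∈ rs, r ∈ I) ∧
      IsRegular (M ⧸ (Ideal.ofList xs • ⊤ : Submodule R M)) rs := by
  induction xs generalizing M with
  | nil =>
    obtain ⟨rs, h1, h2, h3⟩ := h
    refine ⟨rs, by simpa using h1, h2, ?_⟩
    refine ((Submodule.quotEquivOfEqBot _ ?_).isRegular_congr rs).mpr h3
    simp
  | cons x xs ih =>
    rw [isWeaklyRegular_cons_iff] at hreg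
    simp only [List.mem_cons, forall_eq_or_imp] at hxs
    obtain ⟨rs, h1, h2, h3⟩ := ih hxs.2 (smul_top_quotSMulTop_ne_top hxs.1 hI) hreg.2
      (exists_isRegular_quotSMulTop hI hxs.1 hreg.1 h)
    exact ⟨rs, h1, h2, ((Submodule.quotOfListConsSMulTopEquivQuotSMulTopInner M x
      xs).isRegular_congr rs).mpr h3⟩

theorem RingTheory.Sequence.IsWeaklyRegular.isRegular_of_mem {R M : Type*} [CommRing R]
    [AddCommGroup M] [Module R M] {I : Ideal R} (hI : I • (⊤ : Submodule R M) ≠ ⊤) {rs : List R}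
    (h : IsWeaklyRegular M rs) (hrs : ∀ r ∈ rs, r ∈ I) : IsRegular M rs := by
  refine ⟨h, fun he ↦ hI (top_le_iff.mp (he.le.trans (Submodule.smul_mono_left ?_)))⟩
  exact Ideal.span_le.mpr hrs

theorem IsAssociatedPrime.not_isSMulRegular {R M : Type*} [CommRing R] [IsNoetherianRing R]
    [AddCommGroup M] [Module R M] {p : Ideal R} (hp : p ∈ associatedPrimes R M) {r : R}
    (hr : r ∈ p) : ¬ IsSMulRegular M r := by
  have := biUnion_associatedPrimes_eq_compl_regular (R := R) (M := M)
  have h : r ∈ ⋃ p ∈ associatedPrimes R M, (p : Set R) := Set.mem_biUnion hp hr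
  rw [this] at h
  exact h

theorem length_le_of_mem_associatedPrimes {A : Type} [CommRing A] [IsNoetherianRing A]
    {p : Ideal A} {xs ys : List A} (hx : IsWeaklyRegular A xs) (hxp : ∀ x ∈ xs, x ∈ p)
    (hp : p ∈ associatedPrimes A (A ⧸ (Ideal.ofList xs • ⊤ : Submodule A A)))
    (hy : IsWeaklyRegular A ys) (hyp : ∀ y ∈ ys, y ∈ p) : ys.length ≤ xs.length := by
  by_contra! hlt
  have hI : p • (⊤ : Submodule A A) ≠ ⊤ := by simpa using hp.1.ne_top
  have hy' : IsWeaklyRegular A (ys.take (xs.length + 1)) := by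
    rw [← List.take_append_drop (xs.length + 1) ys, isWeaklyRegular_append_iff] at hy
    exact hy.1
  have hyp' : ∀ y ∈ ys.take (xs.length + 1), y ∈ p := fun y h ↦ hyp y (List.mem_of_mem_take h)
  obtain ⟨rs, h1, h2, h3⟩ := exists_isRegular_quotient_ofList (n := 1) xs hxp hI hx
    ⟨ys.take (xs.length + 1), by rw [List.length_take]; omega, hyp', hy'.isRegular_of_mem hI hyp'⟩
  obtain ⟨r, rfl⟩ := List.length_eq_one_iff.mp h1
  exact IsAssociatedPrime.not_isSMulRegular hp (h2 r (by simp))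
    ((isWeaklyRegular_singleton_iff _ r).mp h3.toIsWeaklyRegular)

theorem exists_lt_mem_associatedPrimes_quotSMulTop {R M : Type*} [CommRing R] [IsLocalRing R]
    [IsNoetherianRing R] [AddCommGroup M] [Module R M] [Module.Finite R M] {q : Ideal R}
    (hq : q ∈ associatedPrimes R M) {x : R} (hx : x ∈ IsLocalRing.maximalIdeal R)
    (hreg : IsSMulRegular M x) : ∃ q' ∈ associatedPrimes R (QuotSMulTop x M), q < q' := by
  have hxq : x ∉ q := fun h ↦ IsAssociatedPrime.not_isSMulRegular hq h hreg
  obtain ⟨hqp, m, hm⟩ := isAssociatedPrime_iff.mp hq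
  set N : Submodule R M := Submodule.torsionBySet R M q with hN
  have hmem (y : M) : y ∈ N ↔ ∀ a ∈ q, a • y = 0 := by
    rw [hN, Submodule.mem_torsionBySet_iff]
    simp
  have hNle : ¬ N ≤ x • (⊤ : Submodule R M) := by
    intro hle
    have h1 : N ≤ Ideal.span {x} • N := by
      intro y hy
      obtain ⟨z, -, rfl⟩ := Submodule.mem_smul_pointwise_iff_exists _ _ _ |>.mp (hle hy)
      refine Submodule.smul_mem_smul (Ideal.mem_span_singleton_self x) ?_
      rw [hmem] at hy ⊢
      intro a ha
      apply hreg
      simp only [smul_zero]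
      rw [smul_comm]
      exact hy a ha
    have h2 := Submodule.eq_bot_of_le_smul_of_le_jacobson_bot (Ideal.span {x}) N
      (IsNoetherian.noetherian N) h1 (by
        rw [IsLocalRing.jacobson_eq_maximalIdeal _ bot_ne_top]
        simpa using hx)
    have h3 : m ∈ N := by
      rw [hmem]
      intro a ha
      rw [hm, Submodule.mem_colon_singleton] at ha
      simpa using ha
    rw [h2, Submodule.mem_bot] at h3
    apply hqp.ne_top
    rw [hm, h3, Ideal.eq_top_iff_one, Submodule.mem_colon_singleton]
    simp
  obtain ⟨y, hyN, hy⟩ := SetLike.not_le_iff_exists.mp hNle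
  obtain ⟨q', hq', hle⟩ := exists_le_isAssociatedPrime_of_isNoetherianRing R
    (Submodule.Quotient.mk y : QuotSMulTop x M) (by
      rwa [Ne, Submodule.Quotient.mk_eq_zero])
  refine ⟨q', hq', SetLike.lt_iff_le_and_exists.mpr ⟨fun a ha ↦ hle ?_, x, hle ?_, hxq⟩⟩
  · rw [Submodule.mem_colon_singleton, ← Submodule.Quotient.mk_smul, (hmem y).mp hyN a ha]
    simp
  · rw [Submodule.mem_colon_singleton, ← Submodule.Quotient.mk_smul, Submodule.mem_bot,
      Submodule.Quotient.mk_eq_zero]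
    exact Submodule.smul_mem_pointwise_smul _ _ _ trivial

theorem height_add_length_le_of_mem_associatedPrimes {R : Type*} [CommRing R] [IsLocalRing R]
    [IsNoetherianRing R] (rs : List R) (hrs : ∀ r ∈ rs, r ∈ IsLocalRing.maximalIdeal R)
    {M : Type*} [AddCommGroup M] [Module R M] [Module.Finite R M] (hreg : IsWeaklyRegular M rs)
    {q : Ideal R} (hq : q ∈ associatedPrimes R M) :
    q.height + rs.length ≤ (IsLocalRing.maximalIdeal R).height := by
  induction rs generalizing M q with
  | nil => simpa using Ideal.height_mono (IsLocalRing.le_maximalIdeal hq.1.ne_top)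
  | cons x rs ih =>
    rw [isWeaklyRegular_cons_iff] at hreg
    simp only [List.mem_cons, forall_eq_or_imp] at hrs
    obtain ⟨q', hq', hlt⟩ := exists_lt_mem_associatedPrimes_quotSMulTop hq hrs.1 hreg.1
    have := hq.1
    have := hq'.1
    refine le_trans ?_ (ih hrs.2 hreg.2 hq')
    have := Ideal.height_add_one_le_of_lt_of_isPrime hlt
    calc q.height + ((x :: rs).length : ℕ) = q.height + 1 + rs.length := by
          rw [List.length_cons]; push_cast; ring
      _ ≤ _ := by gcongr

end

section

open RingTheory.Sequence

/-- Every associated prime of the quotient by a weakly regular sequence of length `k` has height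
at most `k`. -/
def UnmixedRegular (A : Type) [CommRing A] : Prop :=
  ∀ xs : List A, IsWeaklyRegular A xs →
    ∀ q ∈ associatedPrimes A (A ⧸ (Ideal.ofList xs • ⊤ : Submodule A A)), q.height ≤ xs.length

theorem Ideal.ofList_smul_top_le_of_mem_associatedPrimes {A : Type*} [CommRing A] {xs : List A}
    {q : Ideal A} (hq : q ∈ associatedPrimes A (A ⧸ (Ideal.ofList xs • ⊤ : Submodule A A))) :
    Ideal.ofList xs ≤ q := by
  have := IsAssociatedPrime.annihilator_le hq
  refine le_trans ?_ this
  intro a ha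
  rw [Submodule.annihilator_top, Ideal.smul_eq_mul, Ideal.mul_top, Ideal.annihilator_quotient]
  exact ha

theorem IsCohenMacaulayLocalRing.unmixedRegular {R : Type} [CommRing R] [IsLocalRing R]
    [IsNoetherianRing R] (h : IsCohenMacaulayLocalRing R) : UnmixedRegular R := by
  obtain ⟨rs, hrs, hreg, hdim⟩ := h
  have hd : (IsLocalRing.maximalIdeal R).height = rs.length := by
    rw [← IsLocalRing.maximalIdeal_height_eq_ringKrullDim] at hdim
    exact_mod_cast hdim.symm
  intro xs hxs q hq
  have hle := Ideal.ofList_smul_top_le_of_mem_associatedPrimes hq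
  have hxq : ∀ x ∈ xs, x ∈ q := fun x hx ↦ hle (Ideal.subset_span hx)
  have hxm : ∀ x ∈ xs, x ∈ IsLocalRing.maximalIdeal R :=
    fun x hx ↦ IsLocalRing.le_maximalIdeal hq.1.ne_top (hxq x hx)
  obtain ⟨p, hp⟩ := associatedPrimes.nonempty R R
  have hlen : xs.length ≤ rs.length := by
    have := height_add_length_le_of_mem_associatedPrimes xs hxm hxs hp
    rw [hd] at this
    exact_mod_cast le_trans le_add_self this
  obtain ⟨ys, hy1, hy2, hy3⟩ := exists_isRegular_quotient_ofList (n := rs.length - xs.length)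
    xs hxm (by simpa using Ideal.IsPrime.ne_top') hxs
    ⟨rs, by omega, hrs, hreg⟩
  have := height_add_length_le_of_mem_associatedPrimes ys hy2 hy3.toIsWeaklyRegular hq
  rw [hd, hy1] at this
  have hfin : q.height ≠ ⊤ := by
    rintro h
    rw [h, top_add] at this
    exact absurd (top_le_iff.mp this) (ENat.natCast_ne_top _)
  lift q.height to ℕ using hfin with a
  norm_cast at this ⊢
  omega

theorem Ideal.exists_isSMulRegular_of_forall_not_le {A M : Type*} [CommRing A]
    [IsNoetherianRing A] [AddCommGroup M] [Module A M] [Module.Finite A M] {I : Ideal A}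
    (h : ∀ q ∈ associatedPrimes A M, ¬ I ≤ q) : ∃ a ∈ I, IsSMulRegular M a := by
  by_contra! hc
  have hsub : (I : Set A) ⊆ ⋃ q ∈ associatedPrimes A M, ((id q : Ideal A) : Set A) := by
    intro a ha
    have := biUnion_associatedPrimes_eq_compl_regular A M
    simp only [id]
    rw [this]
    exact hc a ha
  obtain ⟨q, hq, hle⟩ := (Ideal.subset_union_prime_finite (associatedPrimes.finite A M) (f := id)
    0 0 (fun q hq _ _ ↦ hq.1)).mp hsub
  exact h q hq hle

theorem UnmixedRegular.exists_isWeaklyRegular {A : Type} [CommRing A] [IsNoetherianRing A]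
    (hA : UnmixedRegular A) (I : Ideal A) (k : ℕ)
    (hk : ∀ q : Ideal A, q.IsPrime → I ≤ q → k ≤ q.height) :
    ∃ xs : List A, xs.length = k ∧ (∀ x ∈ xs, x ∈ I) ∧ IsWeaklyRegular A xs := by
  induction k with
  | zero => exact ⟨[], by simp⟩
  | succ k ih =>
    obtain ⟨xs, h1, h2, h3⟩ := ih fun q hq hle ↦ le_trans (by norm_cast; omega) (hk q hq hle)
    obtain ⟨a, ha, hreg⟩ := Ideal.exists_isSMulRegular_of_forall_not_le
      (M := A ⧸ (Ideal.ofList xs • ⊤ : Submodule A A)) (I := I) (by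
        intro q hq hle
        have h4 := hA xs h3 q hq
        have h5 := hk q hq.1 hle
        rw [h1] at h4
        have := h5.trans h4
        norm_cast at this
        omega)
    refine ⟨xs ++ [a], by simp [h1], ?_, ?_⟩
    · simp only [List.mem_append, List.mem_singleton]
      rintro x (hx | rfl)
      exacts [h2 x hx, ha]
    · rw [isWeaklyRegular_append_iff, isWeaklyRegular_singleton_iff]
      exact ⟨h3, hreg⟩

theorem UnmixedRegular.exists_isWeaklyRegular_of_isPrime {A : Type} [CommRing A]
    [IsNoetherianRing A] (hA : UnmixedRegular A) (p : Ideal A) [p.IsPrime] :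
    ∃ xs : List A, xs.length = p.height ∧ (∀ x ∈ xs, x ∈ p) ∧ IsWeaklyRegular A xs := by
  obtain ⟨k, hk⟩ := ENat.ne_top_iff_exists.mp
    (Ideal.height_ne_top (Ideal.IsPrime.ne_top ‹_›) : p.height ≠ ⊤)
  obtain ⟨xs, h⟩ := hA.exists_isWeaklyRegular p k fun q hq hle ↦ hk ▸ Ideal.height_mono hle
  exact ⟨xs, by rw [h.1, hk], h.2⟩

theorem UnmixedRegular.of_exists {A : Type} [CommRing A] [IsNoetherianRing A]
    (h : ∀ p : Ideal A, p.IsPrime → ∃ xs : List A, (∀ x ∈ xs, x ∈ p) ∧ IsWeaklyRegular A xs ∧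
      p.height ≤ xs.length) : UnmixedRegular A := by
  intro xs hxs q hq
  obtain ⟨ys, hy1, hy2, hy3⟩ := h q hq.1
  refine hy3.trans ?_
  norm_cast
  exact length_le_of_mem_associatedPrimes hxs
    (fun x hx ↦ Ideal.ofList_smul_top_le_of_mem_associatedPrimes hq (Ideal.subset_span hx))
    hq hy2 hy1

theorem UnmixedRegular.of_ringEquiv {A B : Type} [CommRing A] [IsNoetherianRing A] [CommRing B]
    (hA : UnmixedRegular A) (e : A ≃+* B) : UnmixedRegular B := by
  have : IsNoetherianRing B := isNoetherianRing_of_ringEquiv A e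
  apply UnmixedRegular.of_exists
  intro p hp
  have hp' : (p.comap e).IsPrime := Ideal.comap_isPrime _ _
  obtain ⟨xs, h1, h2, h3⟩ := hA.exists_isWeaklyRegular_of_isPrime (p.comap e)
  refine ⟨xs.map e, ?_, ?_, ?_⟩
  · simp only [List.mem_map, forall_exists_index, and_imp]
    rintro _ x hx rfl
    exact h2 x hx
  · let := e.toRingHom.toAlgebra
    have : Module.Flat A B := Module.Flat.of_linearEquiv (M := A)
      (LinearEquiv.symm { e with map_smul' := fun r x ↦ by simp [Algebra.smul_def]; rfl })
    exact h3.of_flat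
  · rw [List.length_map, h1, RingEquiv.height_comap]

end

section

open RingTheory.Sequence Polynomial

attribute [local instance] Polynomial.algebra Polynomial.isLocalization in
theorem Polynomial.height_le_one_of_comap_C_eq_bot {D : Type*} [CommRing D] [IsDomain D]
    (Q : Ideal D[X]) [Q.IsPrime] (h : Q.comap C = ⊥) : Q.height ≤ 1 := by
  let K := FractionRing D
  have hdisj : Disjoint ((nonZeroDivisors D).map (C : D →+* D[X]) : Set D[X]) (Q : Set D[X]) := by
    refine Set.disjoint_left.mpr ?_
    rintro _ ⟨b, hb, rfl⟩ hbQ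
    have hb' : b ∈ Q.comap C := hbQ
    rw [h, Ideal.mem_bot] at hb'
    exact nonZeroDivisors.ne_zero hb hb'
  rw [← IsLocalization.height_map_of_disjoint (S := K[X]) ((nonZeroDivisors D).map C) Q hdisj]
  have hp := IsLocalization.isPrime_of_isPrime_disjoint _ K[X] Q inferInstance hdisj
  have h1 := Ideal.height_le_ringKrullDim_of_ne_top hp.ne_top
  have h2 : ringKrullDim K[X] ≤ 1 := Ring.krullDimLE_iff.mp inferInstance
  exact_mod_cast h1.trans h2

theorem Polynomial.height_map_C_of_isPrime {A : Type*} [CommRing A] [IsNoetherianRing A]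
    (p : Ideal A) [hp : p.IsPrime] : (p.map (C : A →+* A[X])).height = p.height := by
  have h1 : (p.map (C : A →+* A[X])).IsPrime := Ideal.isPrime_map_C_of_isPrime
  have : (p.map (C : A →+* A[X])).LiesOver p := ⟨by
    ext a
    change a ∈ p ↔ C a ∈ p.map (C : A →+* A[X])
    rw [Ideal.mem_map_C_iff]
    refine ⟨fun h n ↦ ?_, fun h ↦ by simpa using h 0⟩
    rw [coeff_C]
    split_ifs
    exacts [h, zero_mem _]⟩
  have : IsDomain (A[X] ⧸ p.map (algebraMap A A[X])) := by
    rw [Polynomial.algebraMap_eq]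
    infer_instance
  rw [Ideal.height_eq_height_add_of_liesOver_of_hasGoingDown p, Polynomial.algebraMap_eq,
    Ideal.map_quotient_self]
  rw [Polynomial.algebraMap_eq] at this
  rw [Ideal.height_bot, add_zero]

theorem Polynomial.height_le_height_comap_C_add_one {A : Type*} [CommRing A] [IsNoetherianRing A]
    (P : Ideal A[X]) [hP : P.IsPrime] : P.height ≤ (P.comap C).height + 1 := by
  set p := P.comap (C : A →+* A[X]) with hp
  have : P.LiesOver p := ⟨rfl⟩
  refine (Ideal.height_le_height_add_of_liesOver p P).trans ?_
  gcongr
  rw [Polynomial.algebraMap_eq]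
  let e := (Ideal.polynomialQuotientEquivQuotientPolynomial p).symm
  have hker : RingHom.ker (Ideal.Quotient.mk (p.map (C : A →+* A[X]))) ≤ P := by
    rw [Ideal.mk_ker]
    exact Ideal.map_comap_le
  have hprime : (P.map (Ideal.Quotient.mk (p.map C))).IsPrime :=
    Ideal.map_isPrime_of_surjective Ideal.Quotient.mk_surjective hker
  rw [← RingEquiv.height_comap (Ideal.polynomialQuotientEquivQuotientPolynomial p)]
  have h2 := Ideal.comap_isPrime (Ideal.polynomialQuotientEquivQuotientPolynomial p)
    (P.map (Ideal.Quotient.mk (p.map C)))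
  apply Polynomial.height_le_one_of_comap_C_eq_bot
  rw [eq_bot_iff]
  intro a ha
  obtain ⟨a, rfl⟩ := Ideal.Quotient.mk_surjective a
  rw [Ideal.mem_comap, Ideal.mem_comap] at ha
  have h3 : Ideal.polynomialQuotientEquivQuotientPolynomial p (C (Ideal.Quotient.mk p a)) =
      Ideal.Quotient.mk (p.map C) (C a) := by
    rw [← Polynomial.map_C, Ideal.polynomialQuotientEquivQuotientPolynomial_map_mk]
  rw [h3, ← Ideal.mem_comap, Ideal.comap_map_of_surjective' _ Ideal.Quotient.mk_surjective,
    sup_of_le_left hker] at ha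
  rw [Ideal.mem_bot, Ideal.Quotient.eq_zero_iff_mem]
  exact ha

theorem Polynomial.height_comap_C_add_one_le {A : Type*} [CommRing A] [IsNoetherianRing A]
    (P : Ideal A[X]) [hP : P.IsPrime] (h : P ≠ (P.comap C).map C) :
    (P.comap C).height + 1 ≤ P.height := by
  have : ((P.comap C).map (C : A →+* A[X])).IsPrime := Ideal.isPrime_map_C_of_isPrime
  rw [← Polynomial.height_map_C_of_isPrime (P.comap C)]
  exact Ideal.height_add_one_le_of_lt_of_isPrime (lt_of_le_of_ne Ideal.map_comap_le h.symm)

theorem Polynomial.isSMulRegular_quotient_map_C {A : Type*} [CommRing A] [IsNoetherianRing A]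
    (I : Ideal A) (f : A[X]) (h : ∀ q ∈ associatedPrimes A (A ⧸ I), f ∉ q.map (C : A →+* A[X])) :
    IsSMulRegular (A[X] ⧸ I.map (C : A →+* A[X])) f := by
  have hker : RingHom.ker (mapRingHom (Ideal.Quotient.mk I)) = I.map C := by
    rw [Polynomial.ker_mapRingHom, Ideal.mk_ker]
  rw [isSMulRegular_quotient_iff_mem_of_smul_mem]
  intro x hx
  rw [← hker, RingHom.mem_ker] at hx ⊢
  rw [smul_eq_mul, map_mul] at hx
  by_cases hreg : f.map (Ideal.Quotient.mk I) ∈ nonZeroDivisors (A ⧸ I)[X]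
  · exact (mul_left_mem_nonZeroDivisors_eq_zero_iff hreg).mp hx
  · obtain ⟨a, ha0, ha⟩ := Polynomial.notMem_nonZeroDivisors_iff.mp hreg
    obtain ⟨q, hq, hle⟩ := exists_le_isAssociatedPrime_of_isNoetherianRing A a ha0
    refine absurd (Ideal.mem_map_C_iff.mpr fun n ↦ hle ?_) (h q hq)
    rw [Submodule.mem_colon_singleton, Submodule.mem_bot]
    have := congrArg (fun p ↦ p.coeff n) ha
    simpa [Algebra.smul_def, mul_comm] using this

theorem UnmixedRegular.polynomial {A : Type} [CommRing A] [IsNoetherianRing A]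
    (hA : UnmixedRegular A) : UnmixedRegular A[X] := by
  apply UnmixedRegular.of_exists
  intro P hP
  set p := P.comap (C : A →+* A[X]) with hp
  obtain ⟨xs, h1, h2, h3⟩ := hA.exists_isWeaklyRegular_of_isPrime p
  have h4 := h3.of_flat (S := A[X])
  have h5 : ∀ x ∈ xs.map (algebraMap A A[X]), x ∈ P := by
    simp only [List.mem_map, forall_exists_index, and_imp]
    rintro _ x hx rfl
    exact h2 x hx
  by_cases hPp : P = p.map C
  · refine ⟨_, h5, h4, ?_⟩
    rw [List.length_map, h1, ← Polynomial.height_map_C_of_isPrime p, ← hPp]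
  have hfin := associatedPrimes.finite A (A ⧸ (Ideal.ofList xs • ⊤ : Submodule A A))
  obtain ⟨f, hf, hfq⟩ : ∃ f ∈ P, ∀ q ∈ associatedPrimes A
      (A ⧸ (Ideal.ofList xs • ⊤ : Submodule A A)), f ∉ q.map (C : A →+* A[X]) := by
    by_contra! hc
    have hsub : (P : Set A[X]) ⊆ ⋃ q ∈ associatedPrimes A
        (A ⧸ (Ideal.ofList xs • ⊤ : Submodule A A)),
        ((q.map (C : A →+* A[X]) : Ideal A[X]) : Set A[X]) := by
      intro f hf
      obtain ⟨q, hq, hfq⟩ := hc f hf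
      exact Set.mem_biUnion hq hfq
    obtain ⟨q, hq, hle⟩ := (Ideal.subset_union_prime_finite hfin
      (f := fun q : Ideal A ↦ q.map (C : A →+* A[X])) 0 0
      (fun q hq _ _ ↦ by have := hq.1; exact Ideal.isPrime_map_C_of_isPrime)).mp hsub
    have hpq : p ≤ q := by
      intro a ha
      have := Ideal.mem_map_C_iff.mp (hle ha) 0
      simpa using this
    have := hA xs h3 q hq
    rw [h1] at this
    have heq := Ideal.eq_of_le_of_height_le p hpq this
    rw [← heq] at hle
    exact hPp (le_antisymm hle Ideal.map_comap_le)
  refine ⟨xs.map (algebraMap A A[X]) ++ [f], ?_, ?_, ?_⟩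
  · simp only [List.mem_append, List.mem_singleton]
    rintro x (hx | rfl)
    exacts [h5 x hx, hf]
  · rw [isWeaklyRegular_append_iff, isWeaklyRegular_singleton_iff]
    refine ⟨h4, ?_⟩
    have := Polynomial.isSMulRegular_quotient_map_C _ f hfq
    rwa [smul_eq_mul, Ideal.mul_top, Ideal.map_ofList, ← Ideal.mul_top (Ideal.ofList _),
      ← smul_eq_mul] at this
  · rw [List.length_append, List.length_map, Nat.cast_add, h1]
    simpa using Polynomial.height_le_height_comap_C_add_one P

theorem UnmixedRegular.mvPolynomial {A : Type} [CommRing A] [IsNoetherianRing A]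
    (hA : UnmixedRegular A) (ι : Type) [Finite ι] : UnmixedRegular (MvPolynomial ι A) := by
  suffices IsNoetherianRing (MvPolynomial ι A) ∧ UnmixedRegular (MvPolynomial ι A) from this.2
  induction ι using Finite.induction_empty_option with
  | of_equiv e H =>
    have := H.1
    exact ⟨isNoetherianRing_of_ringEquiv _ (MvPolynomial.renameEquiv A e).toRingEquiv,
      H.2.of_ringEquiv (MvPolynomial.renameEquiv _ e).toRingEquiv⟩
  | h_empty =>
    exact ⟨inferInstance, hA.of_ringEquiv (MvPolynomial.isEmptyRingEquiv A PEmpty).symm⟩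
  | h_option IH =>
    exact ⟨inferInstance,
      IH.2.polynomial.of_ringEquiv (MvPolynomial.optionEquivLeft _ _).symm.toRingEquiv⟩

end

section

open RingTheory.Sequence

theorem Ideal.exists_mem_forall_add_notMem {A : Type*} [CommRing A] (T : Finset (Ideal A))
    (hT : ∀ P ∈ T, P.IsPrime) (a : A) (J : Ideal A) (h : ∀ P ∈ T, a ∈ P → ¬ J ≤ P) :
    ∃ c ∈ J, ∀ P ∈ T, a + c ∉ P := by
  classical
  induction hn : T.card generalizing T with
  | zero =>
    rw [Finset.card_eq_zero] at hn
    exact ⟨0, zero_mem _, by simp [hn]⟩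
  | succ n ih =>
    obtain ⟨P, hP, hmin⟩ := T.exists_minimal (Finset.card_pos.mp (by omega))
    have := hT P hP
    obtain ⟨c, hcJ, hc⟩ := ih (T.erase P) (fun Q hQ ↦ hT Q (Finset.mem_of_mem_erase hQ))
      (fun Q hQ ↦ h Q (Finset.mem_of_mem_erase hQ)) (by rw [Finset.card_erase_of_mem hP, hn]; rfl)
    by_cases hac : a + c ∈ P
    · have hJ : ¬ J ≤ P := fun hle ↦ h P hP (by simpa using P.sub_mem hac (hle hcJ)) hle
      have hprod : ¬ J * ∏ Q ∈ T.erase P, Q ≤ P := by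
        rw [Ideal.IsPrime.mul_le ‹_›, Ideal.IsPrime.prod_le ‹_›]
        rintro (hle | ⟨Q, hQ, hle⟩)
        · exact hJ hle
        · exact Finset.ne_of_mem_erase hQ
            (le_antisymm hle (hmin (Finset.mem_of_mem_erase hQ) hle))
      obtain ⟨d, hd, hdP⟩ := SetLike.not_le_iff_exists.mp hprod
      generalize hK : ∏ Q ∈ T.erase P, Q = K at hd
      have hdJ : d ∈ J := (Ideal.mul_le_inf.trans inf_le_left : J * K ≤ J) hd
      have hdK : d ∈ K := (Ideal.mul_le_inf.trans inf_le_right : J * K ≤ K) hd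
      refine ⟨c + d, J.add_mem hcJ hdJ, fun Q hQ hmem ↦ ?_⟩
      rw [← add_assoc] at hmem
      by_cases hQP : Q = P
      · subst hQP
        exact hdP (by simpa using Q.sub_mem hmem hac)
      · have hQ' := Finset.mem_erase.mpr ⟨hQP, hQ⟩
        have hdQ : d ∈ Q := by
          have hle : K ≤ Q := hK ▸ Ideal.prod_le_inf.trans (Finset.inf_le hQ')
          exact hle hdK
        exact hc Q hQ' (by simpa using Q.sub_mem hmem hdQ)
    · refine ⟨c, hcJ, fun Q hQ ↦ ?_⟩
      by_cases hQP : Q = P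
      · rwa [hQP]
      · exact hc Q (Finset.mem_erase.mpr ⟨hQP, hQ⟩)

theorem UnmixedRegular.exists_isWeaklyRegular_ofList_eq {A : Type} [CommRing A]
    [IsNoetherianRing A] (hA : UnmixedRegular A) (as xs : List A) (hxs : IsWeaklyRegular A xs)
    (h : ∀ Q : Ideal A, Q.IsPrime → Ideal.ofList (xs ++ as) ≤ Q →
      ((xs ++ as).length : ℕ∞) ≤ Q.height) :
    ∃ bs : List A, bs.length = (xs ++ as).length ∧ IsWeaklyRegular A bs ∧
      Ideal.ofList bs = Ideal.ofList (xs ++ as) := by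
  induction as generalizing xs with
  | nil => exact ⟨xs, by simp [hxs]⟩
  | cons a as ih =>
    have hfin := associatedPrimes.finite A (A ⧸ (Ideal.ofList xs • ⊤ : Submodule A A))
    obtain ⟨c, hc, hca⟩ := Ideal.exists_mem_forall_add_notMem hfin.toFinset
      (fun P hP ↦ (hfin.mem_toFinset.mp hP).1) a (Ideal.ofList as) (by
        intro P hP haP hle
        rw [hfin.mem_toFinset] at hP
        have h1 := hA xs hxs P hP
        have h2 := h P hP.1 (by
          rw [Ideal.ofList_append, Ideal.ofList_cons, sup_le_iff, sup_le_iff]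
          exact ⟨Ideal.ofList_smul_top_le_of_mem_associatedPrimes hP,
            (Ideal.span_singleton_le_iff_mem _).mpr haP, hle⟩)
        have h3 := h2.trans h1
        norm_cast at h3
        simp at h3)
    have heq : Ideal.ofList (xs ++ [a + c] ++ as) = Ideal.ofList (xs ++ a :: as) := by
      simp only [Ideal.ofList_append, Ideal.ofList_cons, Ideal.ofList_nil, sup_bot_eq, sup_assoc]
      congr 1
      apply le_antisymm
      · rw [sup_le_iff, Ideal.span_singleton_le_iff_mem]
        exact ⟨Ideal.add_mem _ (Ideal.mem_sup_left (Ideal.mem_span_singleton_self a))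
          (Ideal.mem_sup_right hc), le_sup_right⟩
      · rw [sup_le_iff, Ideal.span_singleton_le_iff_mem]
        refine ⟨?_, le_sup_right⟩
        have := Ideal.sub_mem _ (Ideal.mem_sup_left (Ideal.mem_span_singleton_self (a + c)))
          (Ideal.mem_sup_right hc : c ∈ Ideal.span {a + c} ⊔ Ideal.ofList as)
        simpa using this
    have hlen : (xs ++ [a + c] ++ as).length = (xs ++ a :: as).length := by simp
    have hreg : IsWeaklyRegular A (xs ++ [a + c]) := by
      rw [isWeaklyRegular_append_iff, isWeaklyRegular_singleton_iff]
      refine ⟨hxs, ?_⟩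
      by_contra hn
      have h4 := biUnion_associatedPrimes_eq_compl_regular A
        (A ⧸ (Ideal.ofList xs • ⊤ : Submodule A A))
      have h5 : a + c ∈ ⋃ p ∈ associatedPrimes A (A ⧸ (Ideal.ofList xs • ⊤ : Submodule A A)),
        (p : Set A) := by rw [h4]; exact hn
      simp only [Set.mem_iUnion] at h5
      obtain ⟨P, hP, hmem⟩ := h5
      exact hca P (hfin.mem_toFinset.mpr hP) hmem
    obtain ⟨bs, h1, h2, h3⟩ := ih (xs ++ [a + c]) hreg (by rw [heq, hlen]; exact h)
    exact ⟨bs, by rw [h1, hlen], h2, by rw [h3, heq]⟩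

theorem UnmixedRegular.height_le_of_mem_associatedPrimes {A : Type} [CommRing A]
    [IsNoetherianRing A] (hA : UnmixedRegular A) {s : ℕ} (l : Fin s → A)
    (h : ∀ Q : Ideal A, Q.IsPrime → Ideal.span (Set.range l) ≤ Q → (s : ℕ∞) ≤ Q.height)
    {P : Ideal A} (hP : P ∈ associatedPrimes A (A ⧸ Ideal.span (Set.range l))) :
    P.height ≤ s := by
  have hl : Ideal.ofList (List.ofFn l) = Ideal.span (Set.range l) := by
    rw [Ideal.ofList]
    congr 1
    ext x
    simp
  obtain ⟨bs, h1, h2, h3⟩ := hA.exists_isWeaklyRegular_ofList_eq (List.ofFn l) [] (by simp)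
    (by simpa [hl] using h)
  simp only [List.nil_append, List.length_ofFn] at h1 h3
  rw [← h1]
  apply hA bs h2
  rwa [smul_eq_mul, Ideal.mul_top, h3, hl]

end

section

open MvPolynomial

theorem Ideal.height_comap_le_of_flat {A B : Type*} [CommRing A] [IsNoetherianRing A] [CommRing B]
    [IsNoetherianRing B] [Algebra A B] [Module.Flat A B] (Q : Ideal B) [Q.IsPrime] :
    (Q.comap (algebraMap A B)).height ≤ Q.height := by
  have : Q.LiesOver (Q.comap (algebraMap A B)) := ⟨rfl⟩
  rw [Ideal.height_eq_height_add_of_liesOver_of_hasGoingDown (Q.comap (algebraMap A B)) Q]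
  exact le_self_add

theorem MvPolynomial.height_comap_C_add_le {A : Type*} [CommRing A] [IsNoetherianRing A] (r : ℕ)
    (Q : Ideal (MvPolynomial (Fin r) A)) [Q.IsPrime]
    (h : ∀ i, ∃ a b : A, C a * X i + C b ∈ Q ∧ C a ∉ Q) :
    (Q.comap C).height + r ≤ Q.height := by
  induction r with
  | zero => simpa using Ideal.height_comap_le_of_flat (A := A) Q
  | succ r ih =>
    let e := (finSuccEquiv A r).toRingEquiv
    have heC (a : A) : e (C a) = Polynomial.C (C a) := (finSuccEquiv A r).commutes a
    let Q' := Q.comap e.symm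
    have hQ' : Q'.IsPrime := Ideal.comap_isPrime _ _
    have hmem (x) : x ∈ Q ↔ e x ∈ Q' := by simp [Q']
    have hht : Q'.height = Q.height := RingEquiv.height_comap _ _
    let Q₀ := Q'.comap Polynomial.C
    have h0 : (Q₀.comap C).height + r ≤ Q₀.height := by
      apply ih
      intro i
      obtain ⟨a, b, h1, h2⟩ := h i.succ
      refine ⟨a, b, ?_, ?_⟩
      · rw [hmem, map_add, map_mul, heC, heC] at h1
        have : e (X i.succ) = Polynomial.C (X i) := finSuccEquiv_X_succ
        rwa [this, ← Polynomial.C_mul, ← Polynomial.C_add] at h1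
      · rwa [hmem, heC] at h2
    have h3 : Q₀.comap C = Q.comap C := by
      ext a
      change Polynomial.C (C a) ∈ Q' ↔ C a ∈ Q
      rw [hmem (C a), heC]
    have h4 : Q₀.height + 1 ≤ Q'.height := by
      apply Polynomial.height_comap_C_add_one_le
      intro heq
      obtain ⟨a, b, h1, h2⟩ := h 0
      rw [hmem, map_add, map_mul, heC, heC] at h1
      have : e (X 0) = Polynomial.X := finSuccEquiv_X_zero
      rw [this, heq, Ideal.mem_map_C_iff] at h1
      have h5 := h1 1
      rw [Polynomial.coeff_add, Polynomial.coeff_C_mul, Polynomial.coeff_X_one,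
        Polynomial.coeff_C_of_ne_zero one_ne_zero, mul_one, add_zero, Ideal.mem_comap] at h5
      exact h2 (by rwa [hmem, heC])
    rw [← hht, ← h3]
    refine le_trans ?_ h4
    push_cast
    rw [← add_assoc]
    gcongr

/-- The linear form `∑ i, M i j * X i` attached to a column of a matrix. -/
def Matrix.linForm {R ι κ : Type*} [CommRing R] [Fintype ι] (M : Matrix ι κ R) (j : κ) :
    MvPolynomial ι R :=
  ∑ i, C (M i j) * X i

theorem Matrix.height_comap_C_add_le_of_sum {R β κ : Type*} [CommRing R] [IsNoetherianRing R]
    [Fintype β] {r : ℕ} (M : Matrix (Fin r ⊕ β) κ R) (Q : Ideal (MvPolynomial (Fin r ⊕ β) R))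
    [Q.IsPrime] (hM : ∀ j, M.linForm j ∈ Q) (g : Fin r → κ)
    (hδ : C (M.submatrix Sum.inl g).det ∉ Q) :
    (Q.comap C).height + r ≤ Q.height := by
  let e := (sumAlgEquiv R (Fin r) β).toRingEquiv
  have heC (a : R) : e (C a) = C (C a) := sumAlgEquiv_C_inl _ _ _ a
  have hel (i : Fin r) : e (X (Sum.inl i)) = X i := sumAlgEquiv_X_inl _ _ _ i
  have her (i : β) : e (X (Sum.inr i)) = C (X i) := sumAlgEquiv_X_inr _ _ _ i
  let Q' := Q.comap e.symm
  have hQ' : Q'.IsPrime := Ideal.comap_isPrime _ _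
  have hmem (x) : x ∈ Q ↔ e x ∈ Q' := by simp [Q']
  have hht : Q'.height = Q.height := RingEquiv.height_comap _ _
  have h1 : (Q'.comap C).height + r ≤ Q'.height := by
    apply MvPolynomial.height_comap_C_add_le
    intro k
    set N := M.submatrix Sum.inl g with hN
    refine ⟨C N.det, ∑ b, C (∑ m, M (Sum.inr b) (g m) * N.adjugate m k) * X b, ?_, ?_⟩
    · have h2 : ∑ m, M.linForm (g m) * C (N.adjugate m k) ∈ Q :=
        Ideal.sum_mem _ fun m _ ↦ Ideal.mul_mem_right _ _ (hM _)
      have h3 : ∑ m, M.linForm (g m) * C (N.adjugate m k) =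
          ∑ i, C (∑ m, M i (g m) * N.adjugate m k) * X i := by
        simp only [Matrix.linForm, Finset.sum_mul, map_sum, C_mul]
        rw [Finset.sum_comm]
        refine Finset.sum_congr rfl fun i _ ↦ Finset.sum_congr rfl fun m _ ↦ by ring
      rw [h3, Fintype.sum_sum_type, hmem, map_add, map_sum, map_sum] at h2
      convert h2 using 2
      · have h4 (i : Fin r) : ∑ m, M (Sum.inl i) (g m) * N.adjugate m k =
            if i = k then N.det else 0 := by
          have := congrFun (congrFun N.mul_adjugate i) k
          rw [Matrix.mul_apply] at this
          rw [Matrix.smul_apply, Matrix.one_apply] at this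
          rw [hN] at this ⊢
          simpa using this
        simp only [h4, map_mul, heC, hel]
        rw [Finset.sum_eq_single k]
        · simp
        · intro i _ hi
          simp [hi]
        · simp
      · rw [map_sum]
        refine Finset.sum_congr rfl fun b _ ↦ ?_
        rw [map_mul e, heC, her, C_mul]
    · rwa [hmem, heC] at hδ
  have h2 := Ideal.height_comap_le_of_flat (A := R) (Q'.comap (C : MvPolynomial β R →+* _))
  rw [← hht]
  have h3 : (Q'.comap (C : MvPolynomial β R →+* _)).comap (algebraMap R _) = Q.comap C := by
    ext a
    change C (C a) ∈ Q' ↔ C a ∈ Q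
    rw [hmem (C a), heC]
  rw [h3] at h2
  exact (add_le_add_left h2 _).trans h1

theorem Matrix.injective_of_det_submatrix_ne_zero {R ι κ : Type*} [CommRing R] {r : ℕ}
    (M : Matrix ι κ R) (f : Fin r → ι) (g : Fin r → κ) (h : (M.submatrix f g).det ≠ 0) :
    Function.Injective f := by
  intro a b hab
  by_contra hne
  exact h (Matrix.det_zero_of_row_eq hne (by ext j; simp [hab]))

theorem Matrix.height_comap_C_add_le {R ι κ : Type*} [CommRing R] [IsNoetherianRing R]
    [Fintype ι] {r : ℕ} (M : Matrix ι κ R) (Q : Ideal (MvPolynomial ι R))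
    [Q.IsPrime] (hM : ∀ j, M.linForm j ∈ Q) (f : Fin r → ι) (g : Fin r → κ)
    (hδ : C (M.submatrix f g).det ∉ Q) :
    (Q.comap C).height + r ≤ Q.height := by
  classical
  have hf : Function.Injective f := M.injective_of_det_submatrix_ne_zero f g (by
    intro h0
    simp [h0] at hδ)
  let β := ((Set.range f)ᶜ : Set ι)
  let σ : ι ≃ Fin r ⊕ β := ((Equiv.ofInjective f hf).sumCongr (Equiv.refl β)).trans
    (Equiv.Set.sumCompl (Set.range f)) |>.symm
  have hσ (k : Fin r) : σ.symm (Sum.inl k) = f k := rfl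
  let e := (renameEquiv R σ).toRingEquiv
  have heC (a : R) : e (C a) = C a := (renameEquiv R σ).commutes a
  have heX (i : ι) : e (X i) = X (σ i) := rename_X _ _
  let Q' := Q.comap e.symm
  have hQ' : Q'.IsPrime := Ideal.comap_isPrime _ _
  have hmem (x) : x ∈ Q ↔ e x ∈ Q' := by simp [Q']
  have hht : Q'.height = Q.height := RingEquiv.height_comap _ _
  have h1 := Matrix.height_comap_C_add_le_of_sum (M.submatrix σ.symm id) Q' (by
    intro j
    have h2 := (hmem _).mp (hM j)
    rw [Matrix.linForm, map_sum] at h2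
    rw [Matrix.linForm, ← σ.sum_comp]
    simpa only [map_mul, heC, heX, Matrix.submatrix_apply, Equiv.symm_apply_apply, id] using h2)
    g (by
    rw [hmem, heC] at hδ
    have h4 : (M.submatrix σ.symm id).submatrix Sum.inl g = M.submatrix f g := by
      ext i j
      simp [hσ]
    rwa [h4])
  have h3 : Q'.comap C = Q.comap C := by
    ext a
    change C a ∈ Q' ↔ C a ∈ Q
    rw [hmem (C a), heC]
  rwa [← hht, ← h3]

end

section

open MvPolynomial

theorem Matrix.exists_det_submatrix_cons_eq {R ι κ : Type*} [CommRing R] (M : Matrix ι κ R)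
    {r : ℕ} (f : Fin r → ι) (g : Fin r → κ) (j : κ) :
    ∃ w : Fin r → R, ∀ i, (M.submatrix (Fin.cons i f : Fin (r + 1) → ι)
      (Fin.cons j g : Fin (r + 1) → κ)).det =
      (M.submatrix f g).det * M i j + ∑ k, w k * M i (g k) := by
  refine ⟨fun k ↦ (-1) ^ (k.succ : ℕ) * (M.submatrix f
    ((Fin.cons j g : Fin (r + 1) → κ) ∘ k.succ.succAbove)).det, fun i ↦ ?_⟩
  rw [Matrix.det_succ_row_zero, Fin.sum_univ_succ]
  congr 1
  · simp only [Fin.val_zero, pow_zero, one_mul, Matrix.submatrix_apply, Fin.cons_zero,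
      Matrix.submatrix_submatrix, Fin.succAbove_zero]
    rw [mul_comm]
    rfl
  · refine Finset.sum_congr rfl fun k _ ↦ ?_
    simp only [Matrix.submatrix_apply, Fin.cons_zero, Fin.cons_succ, Matrix.submatrix_submatrix]
    have : (Fin.cons i f : Fin (r + 1) → ι) ∘ Fin.succ = f := rfl
    rw [this]
    ring

theorem minorsIdeal_zero {R : Type} [CommRing R] {n m : Type} [Fintype n] [Fintype m]
    (M : Matrix n m R) : minorsIdeal M 0 = ⊤ := by
  rw [Ideal.eq_top_iff_one]
  exact Ideal.subset_span ⟨Fin.elim0, Fin.elim0, by simp⟩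

theorem minorsIdeal_succ_le {R : Type} [CommRing R] {n m : Type} [Fintype n] [Fintype m]
    (M : Matrix n m R) (t : ℕ) : minorsIdeal M (t + 1) ≤ minorsIdeal M t := by
  refine Ideal.span_le.mpr ?_
  rintro _ ⟨f, g, rfl⟩
  rw [Matrix.det_succ_row_zero]
  exact Ideal.sum_mem _ fun j _ ↦ Ideal.mul_mem_left _ _ (Ideal.subset_span
    ⟨f ∘ Fin.succ, g ∘ j.succAbove, by rw [Matrix.submatrix_submatrix]⟩)

theorem minorsIdeal_antitone {R : Type} [CommRing R] {n m : Type} [Fintype n] [Fintype m]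
    (M : Matrix n m R) : Antitone (minorsIdeal M) :=
  antitone_nat_of_succ_le (minorsIdeal_succ_le M)

theorem exists_det_submatrix_notMem {R : Type} [CommRing R] {n m : Type} [Fintype n] [Fintype m]
    (M : Matrix n m R) {t : ℕ} {I : Ideal R} (h : ¬ minorsIdeal M t ≤ I) :
    ∃ (f : Fin t → n) (g : Fin t → m), (M.submatrix f g).det ∉ I := by
  by_contra! hc
  refine h (Ideal.span_le.mpr ?_)
  rintro _ ⟨f, g, rfl⟩
  exact hc f g

theorem exists_lt_minorsIdeal_le {R : Type} [CommRing R] {n m : Type} [Fintype n] [Fintype m]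
    (M : Matrix n m R) {t : ℕ} {I : Ideal R} (hI : I ≠ ⊤) (h : minorsIdeal M t ≤ I) :
    ∃ r < t, ¬ minorsIdeal M r ≤ I ∧ minorsIdeal M (r + 1) ≤ I := by
  classical
  have hex : ∃ k, minorsIdeal M k ≤ I := ⟨t, h⟩
  have h0 : Nat.find hex ≠ 0 := by
    intro h0
    have := Nat.find_spec hex
    rw [h0, minorsIdeal_zero, top_le_iff] at this
    exact hI this
  have hle := Nat.find_min' hex h
  refine ⟨Nat.find hex - 1, by omega, Nat.find_min hex (by omega), ?_⟩
  rw [Nat.sub_add_cancel (by omega)]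
  exact Nat.find_spec hex

theorem not_minorsIdeal_le_of_mem_associatedPrimes {R : Type} [CommRing R] [IsNoetherianRing R]
    {n : Type} [Fintype n] {s : ℕ} (M : Matrix n (Fin s) R)
    (hinj : Function.Injective M.mulVecLin) {p : Ideal R} (hp : p ∈ associatedPrimes R R) :
    ¬ minorsIdeal M s ≤ p := by
  intro hle
  obtain ⟨hpp, a, ha⟩ := isAssociatedPrime_iff.mp hp
  have ha' (x : R) : x ∈ p ↔ x * a = 0 := by
    rw [ha, Submodule.mem_colon_singleton, smul_eq_mul, Submodule.mem_bot]
  obtain ⟨r, hr, h1, h2⟩ := exists_lt_minorsIdeal_le M hpp.ne_top hle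
  obtain ⟨f, g, hδ⟩ := exists_det_submatrix_notMem M h1
  obtain ⟨j, hj⟩ : ∃ j, j ∉ Set.range g := by
    by_contra! hc
    have := Fintype.card_le_of_surjective g hc
    simp only [Fintype.card_fin] at this
    omega
  obtain ⟨w, hw⟩ := M.exists_det_submatrix_cons_eq f g j
  set δ := (M.submatrix f g).det with hδdef
  let v : Fin s → R := a • (Pi.single j δ + ∑ k, Pi.single (g k) (w k))
  have hv : M.mulVecLin v = 0 := by
    ext i
    have h3 : (M.submatrix (Fin.cons i f : Fin (r + 1) → n)
      (Fin.cons j g : Fin (r + 1) → Fin s)).det ∈ p := h2 (Ideal.subset_span ⟨_, _, rfl⟩)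
    rw [ha', hw] at h3
    simp only [v, map_smul, map_add, map_sum, Matrix.mulVecLin_apply, Matrix.mulVec_single,
      Pi.smul_apply, Pi.add_apply, Finset.sum_apply, Matrix.col_apply, Pi.zero_apply,
      MulOpposite.smul_eq_mul_unop, MulOpposite.unop_op, smul_eq_mul]
    rw [← h3, mul_comm a]
    congr 2
    · ring
    · exact Finset.sum_congr rfl fun k _ ↦ mul_comm _ _
  have hv0 : v = 0 := hinj (by rw [hv, map_zero])
  have hvj := congrFun hv0 j
  have h5 (k : Fin r) : (Pi.single (g k) (w k) : Fin s → R) j = 0 := by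
    rw [Pi.single_eq_of_ne]
    rintro rfl
    exact hj ⟨k, rfl⟩
  simp only [v, Pi.smul_apply, Pi.add_apply, Pi.single_eq_same, Finset.sum_apply, h5,
    Finset.sum_const_zero, add_zero, Pi.zero_apply, smul_eq_mul] at hvj
  exact hδ ((ha' _).mpr (by rw [mul_comm]; exact hvj))

theorem exists_mem_minorsIdeal_mem_nonZeroDivisors {R : Type} [CommRing R] [IsNoetherianRing R]
    {n : Type} [Fintype n] {s : ℕ} (M : Matrix n (Fin s) R)
    (hinj : Function.Injective M.mulVecLin) :
    ∃ c ∈ minorsIdeal M s, c ∈ nonZeroDivisors R := by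
  obtain ⟨c, hc, hreg⟩ := Ideal.exists_isSMulRegular_of_forall_not_le (M := R)
    fun q hq ↦ not_minorsIdeal_le_of_mem_associatedPrimes M hinj hq
  refine ⟨c, hc, mem_nonZeroDivisors_iff_right.mpr fun x hx ↦ hreg ?_⟩
  simpa [mul_comm] using hx

theorem Matrix.exists_isPrime_linForm_mem {R : Type} [CommRing R] [IsNoetherianRing R]
    {n m : Type} [Fintype n] [Fintype m] (M : Matrix n m R) (p : Ideal R) [hp : p.IsPrime] {r : ℕ}
    (f : Fin r → n) (g : Fin r → m) (hδ : (M.submatrix f g).det ∉ p)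
    (hle : minorsIdeal M (r + 1) ≤ p) :
    ∃ P : Ideal (MvPolynomial n R), P.IsPrime ∧ P.comap C = p ∧ (∀ j, M.linForm j ∈ P) ∧
      P.height ≤ p.height + r := by
  classical
  let I : Ideal (MvPolynomial n R) := p.map C ⊔ Ideal.span (Set.range fun k ↦ M.linForm (g k))
  have hI : I ≤ p.comap constantCoeff := by
    refine sup_le (Ideal.map_le_iff_le_comap.mpr fun a ha ↦ ?_) (Ideal.span_le.mpr ?_)
    · simpa using ha
    · rintro _ ⟨k, rfl⟩
      simp [Matrix.linForm]
  have hdisj : Disjoint (I : Set (MvPolynomial n R))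
      (p.primeCompl.map (C : R →+* MvPolynomial n R) : Set (MvPolynomial n R)) := by
    refine Set.disjoint_left.mpr ?_
    rintro _ hx ⟨a, ha, rfl⟩
    exact ha (by simpa using hI hx)
  obtain ⟨P', hP', hIP', hdisj'⟩ := Ideal.exists_le_prime_disjoint I _ hdisj
  obtain ⟨P, hP, hPP'⟩ := Ideal.exists_minimalPrimes_le hIP'
  have hPprime : P.IsPrime := hP.1.1
  have hIP : I ≤ P := hP.1.2
  have hcomap : P.comap C = p := by
    refine le_antisymm (fun a ha ↦ ?_) (Ideal.map_le_iff_le_comap.mp (le_sup_left.trans hIP))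
    by_contra hap
    exact Set.disjoint_left.mp hdisj' (hPP' ha) ⟨a, hap, rfl⟩
  refine ⟨P, hPprime, hcomap, fun j ↦ ?_, ?_⟩
  · obtain ⟨w, hw⟩ := M.exists_det_submatrix_cons_eq f g j
    have h1 : C (M.submatrix f g).det * M.linForm j + ∑ k, C (w k) * M.linForm (g k) ∈ P := by
      have h2 : C (M.submatrix f g).det * M.linForm j + ∑ k, C (w k) * M.linForm (g k) =
          ∑ i, C (M.submatrix (Fin.cons i f : Fin (r + 1) → n)
            (Fin.cons j g : Fin (r + 1) → m)).det * X i := by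
        simp only [hw, Matrix.linForm, Finset.mul_sum, C_add, C_mul, map_sum, add_mul,
          Finset.sum_add_distrib, Finset.sum_mul]
        congr 1
        · exact Finset.sum_congr rfl fun i _ ↦ by ring
        · rw [Finset.sum_comm]
          exact Finset.sum_congr rfl fun i _ ↦ Finset.sum_congr rfl fun k _ ↦ by ring
      rw [h2]
      refine Ideal.sum_mem _ fun i _ ↦ Ideal.mul_mem_right _ _ ?_
      rw [← Ideal.mem_comap, hcomap]
      exact hle (Ideal.subset_span ⟨_, _, rfl⟩)
    have h3 : ∑ k, C (w k) * M.linForm (g k) ∈ P := Ideal.sum_mem _ fun k _ ↦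
      Ideal.mul_mem_left _ _ (hIP (Ideal.mem_sup_right (Ideal.subset_span ⟨k, rfl⟩)))
    have h4 : C (M.submatrix f g).det * M.linForm j ∈ P := by
      simpa using P.sub_mem h1 h3
    refine (hPprime.mem_or_mem h4).resolve_left fun h5 ↦ hδ ?_
    rwa [← Ideal.mem_comap, hcomap] at h5
  · obtain ⟨x, hx, hcard⟩ := p.exists_finset_card_eq_height_of_isNoetherianRing
    let T : Finset (MvPolynomial n R) :=
      x.image C ∪ Finset.univ.image fun k ↦ M.linForm (g k)
    have hT : Ideal.span (T : Set (MvPolynomial n R)) =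
        (Ideal.span (x : Set R)).map C ⊔ Ideal.span (Set.range fun k ↦ M.linForm (g k)) := by
      simp only [T, Finset.coe_union, Finset.coe_image, Finset.coe_univ, Set.image_univ,
        Ideal.span_union, Ideal.map_span]
    have hmin : P ∈ (Ideal.span (T : Set (MvPolynomial n R))).minimalPrimes := by
      rw [hT]
      refine ⟨⟨hPprime, le_trans ?_ hIP⟩, ?_⟩
      · exact sup_le_sup_right (Ideal.map_mono hx.1.2) _
      · rintro Q ⟨hQ, hQle⟩ hQP
        refine hP.2 ⟨hQ, sup_le ?_ (le_sup_right.trans hQle)⟩ hQP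
        rw [Ideal.map_le_iff_le_comap]
        refine hx.2 ⟨Ideal.comap_isPrime _ _, ?_⟩ ?_
        · exact Ideal.map_le_iff_le_comap.mp (le_sup_left.trans hQle)
        · rw [← hcomap]
          exact Ideal.comap_mono hQP
    refine (Ideal.height_le_card_of_mem_minimalPrimes_span_finset hmin).trans ?_
    rw [← hcard]
    norm_cast
    refine (Finset.card_union_le _ _).trans (add_le_add Finset.card_image_le ?_)
    exact Finset.card_image_le.trans (by simp)

end

section

open TensorProduct

theorem Module.finrank_add_finrank_of_exact {A M N P : Type*} [CommRing A] [Nontrivial A]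
    [AddCommGroup M] [Module A M] [AddCommGroup N] [Module A N] [AddCommGroup P] [Module A P]
    [Module.Free A M] [Module.Finite A M] [Module.Free A P] [Module.Finite A P]
    {f : M →ₗ[A] N} {g : N →ₗ[A] P} (hf : Function.Injective f) (hg : Function.Surjective g)
    (h : Function.Exact f g) : Module.finrank A N = Module.finrank A M + Module.finrank A P := by
  obtain ⟨l, hl⟩ := Module.projective_lifting_property g LinearMap.id hg
  rw [(h.splitSurjectiveEquiv hf ⟨l, hl⟩).1.finrank_eq, Module.finrank_prod]

theorem hasRank.eq_add {R E : Type} [CommRing R] [Nontrivial R] [IsNoetherianRing R]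
    [AddCommGroup E] [Module R E] [Module.Finite R E] {e : ℕ} (hrk : hasRank R E e) {n s : ℕ}
    {f : (Fin s → R) →ₗ[R] (Fin n → R)} {g : (Fin n → R) →ₗ[R] E} (hf : Function.Injective f)
    (hg : Function.Surjective g) (h : Function.Exact f g) : n = s + e := by
  obtain ⟨p, hp⟩ := associatedPrimes.nonempty R R
  have := hp.1
  obtain ⟨hfree, hrank⟩ := hrk p hp.1 hp
  let A := Localization.AtPrime p
  let ε : A ⊗[R] E ≃ₗ[A] LocalizedModule p.primeCompl E :=
    (IsLocalizedModule.isBaseChange p.primeCompl A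
      (LocalizedModule.mkLinearMap p.primeCompl E)).equiv
  have hfree' : Module.Free A (A ⊗[R] E) := Module.Free.of_equiv ε.symm
  have h1 : Function.Injective (f.baseChange A) :=
    Module.Flat.lTensor_preserves_injective_linearMap f hf
  have h2 : Function.Surjective (g.baseChange A) := LinearMap.lTensor_surjective A hg
  have h3 : Function.Exact (f.baseChange A) (g.baseChange A) := lTensor_exact A h hg
  have h4 := Module.finrank_add_finrank_of_exact h1 h2 h3
  rw [ε.finrank_eq, hrank, Module.finrank_baseChange, Module.finrank_baseChange,
    Module.finrank_fin_fun, Module.finrank_fin_fun] at h4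
  exact h4

open MvPolynomial

/-- The canonical map from a module to its symmetric algebra. -/
def SymmAlgebra.ι (R M : Type) [CommRing R] [AddCommGroup M] [Module R M] :
    M →ₗ[R] SymmAlgebra R M where
  toFun x := Ideal.Quotient.mk _ (X x)
  map_add' x y := by
    rw [← map_add, Ideal.Quotient.eq]
    refine Ideal.subset_span (Or.inl ⟨x, y, ?_⟩)
    ring
  map_smul' r x := by
    rw [RingHom.id_apply, ← Ideal.Quotient.mkₐ_eq_mk R, ← map_smul, Ideal.Quotient.mkₐ_eq_mk,
      Ideal.Quotient.eq, smul_eq_C_mul]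
    exact Ideal.subset_span (Or.inr ⟨r, x, rfl⟩)

/-- The extension of a linear map from a module to an algebra to the symmetric algebra. -/
def SymmAlgebra.lift {R M B : Type} [CommRing R] [AddCommGroup M] [Module R M] [CommRing B]
    [Algebra R B] (μ : M →ₗ[R] B) : SymmAlgebra R M →ₐ[R] B :=
  Ideal.Quotient.liftₐ _ (aeval μ) (by
    intro a ha
    rw [← RingHom.mem_ker (f := (aeval μ : MvPolynomial M R →ₐ[R] B))]
    refine Ideal.span_le.mpr ?_ ha
    rintro _ (⟨x, y, rfl⟩ | ⟨r, x, rfl⟩)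
    · simp
    · simp [Algebra.smul_def])

theorem SymmAlgebra.lift_ι {R M B : Type} [CommRing R] [AddCommGroup M] [Module R M] [CommRing B]
    [Algebra R B] (μ : M →ₗ[R] B) (x : M) : SymmAlgebra.lift μ (SymmAlgebra.ι R M x) = μ x := by
  change aeval μ (X x : MvPolynomial M R) = μ x
  simp

theorem SymmAlgebra.algHom_ext {R M B : Type} [CommRing R] [AddCommGroup M] [Module R M]
    [CommRing B] [Algebra R B] {F G : SymmAlgebra R M →ₐ[R] B}
    (h : ∀ x, F (SymmAlgebra.ι R M x) = G (SymmAlgebra.ι R M x)) : F = G := by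
  refine Ideal.Quotient.algHom_ext _ (MvPolynomial.algHom_ext fun x ↦ h x)

theorem Matrix.linForm_eq_linearCombination {R ι κ : Type*} [CommRing R] [Fintype ι]
    (M : Matrix ι κ R) (j : κ) :
    M.linForm j = Fintype.linearCombination R (X : ι → MvPolynomial ι R) (M.col j) := by
  simp [Matrix.linForm, Fintype.linearCombination_apply, smul_eq_C_mul]

/-- The symmetric algebra of the cokernel of a matrix is the quotient of the polynomial ring by
the linear forms attached to the columns. -/
theorem SymmAlgebra.nonempty_algEquiv {R E : Type} [CommRing R] [AddCommGroup E] [Module R E]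
    {n s : ℕ} (φ : Matrix (Fin n) (Fin s) R) (g : (Fin n → R) →ₗ[R] E)
    (hg : Function.Surjective g) (hker : LinearMap.ker g = LinearMap.range φ.mulVecLin) :
    Nonempty (SymmAlgebra R E ≃ₐ[R]
      MvPolynomial (Fin n) R ⧸ Ideal.span (Set.range φ.linForm)) := by
  classical
  let J := Ideal.span (Set.range φ.linForm)
  let lam : (Fin n → R) →ₗ[R] MvPolynomial (Fin n) R ⧸ J :=
    (Ideal.Quotient.mkₐ R J).toLinearMap ∘ₗ
      Fintype.linearCombination R (X : Fin n → MvPolynomial (Fin n) R)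
  have hlam (i : Fin n) : lam (Pi.single i 1) = Ideal.Quotient.mk J (X i) := by
    simp [lam, Fintype.linearCombination_apply_single]
  have hcol (j : Fin s) : φ.mulVecLin (Pi.single j 1) = φ.col j := by
    simp
  have hle : LinearMap.ker g ≤ LinearMap.ker lam := by
    rw [hker, LinearMap.range_le_ker_iff]
    refine LinearMap.pi_ext' fun j ↦ LinearMap.ext_ring ?_
    change lam (φ.mulVecLin (Pi.single j 1)) = 0
    rw [hcol]
    change Ideal.Quotient.mk J (Fintype.linearCombination R _ (φ.col j)) = 0
    rw [← Matrix.linForm_eq_linearCombination, Ideal.Quotient.eq_zero_iff_mem]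
    exact Ideal.subset_span ⟨j, rfl⟩
  let μ : E →ₗ[R] MvPolynomial (Fin n) R ⧸ J :=
    (Submodule.liftQ _ lam hle) ∘ₗ (g.quotKerEquivOfSurjective hg).symm.toLinearMap
  have hμ (v : Fin n → R) : μ (g v) = lam v := by
    have : (g.quotKerEquivOfSurjective hg).symm (g v) = Submodule.Quotient.mk v := by
      rw [LinearEquiv.symm_apply_eq]
      rfl
    simp only [μ, LinearMap.comp_apply, LinearEquiv.coe_coe, this]
    rfl
  let ψ : MvPolynomial (Fin n) R →ₐ[R] SymmAlgebra R E :=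
    aeval fun i ↦ SymmAlgebra.ι R E (g (Pi.single i 1))
  have hψ (v : Fin n → R) : ψ (Fintype.linearCombination R X v) = SymmAlgebra.ι R E (g v) := by
    have : ψ.toLinearMap ∘ₗ Fintype.linearCombination R X = SymmAlgebra.ι R E ∘ₗ g := by
      refine LinearMap.pi_ext' fun i ↦ LinearMap.ext_ring ?_
      simp [ψ, Fintype.linearCombination_apply_single]
    exact LinearMap.congr_fun this v
  let G : (MvPolynomial (Fin n) R ⧸ J) →ₐ[R] SymmAlgebra R E :=
    Ideal.Quotient.liftₐ J ψ (by
      intro a ha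
      rw [← RingHom.mem_ker (f := ψ)]
      refine Ideal.span_le.mpr ?_ ha
      rintro _ ⟨j, rfl⟩
      have hz : g (φ.col j) = 0 := by
        rw [← LinearMap.mem_ker, hker, ← hcol]
        exact ⟨_, rfl⟩
      rw [SetLike.mem_coe, RingHom.mem_ker, Matrix.linForm_eq_linearCombination, hψ, hz, map_zero])
  have hG (x) : G (Ideal.Quotient.mk J x) = ψ x := rfl
  refine ⟨AlgEquiv.ofAlgHom (SymmAlgebra.lift μ) G ?_ ?_⟩
  · refine Ideal.Quotient.algHom_ext _ (MvPolynomial.algHom_ext fun i ↦ ?_)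
    change SymmAlgebra.lift μ (ψ (X i)) = Ideal.Quotient.mk J (X i)
    simp only [ψ, aeval_X, SymmAlgebra.lift_ι, hμ, hlam]
  · refine SymmAlgebra.algHom_ext fun x ↦ ?_
    obtain ⟨v, rfl⟩ := hg x
    rw [AlgHom.comp_apply, SymmAlgebra.lift_ι, hμ, AlgHom.id_apply]
    exact hψ v

theorem Submodule.torsion_eq_bot_iff_forall_isSMulRegular {R M : Type*} [CommRing R]
    [AddCommGroup M] [Module R M] :
    Submodule.torsion R M = ⊥ ↔ ∀ c ∈ nonZeroDivisors R, IsSMulRegular M c := by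
  rw [eq_bot_iff]
  constructor
  · intro h c hc
    rw [isSMulRegular_iff_right_eq_zero_of_smul]
    intro m hm
    exact h ⟨⟨c, hc⟩, hm⟩
  · rintro h x ⟨⟨c, hc⟩, hx⟩
    exact isSMulRegular_iff_right_eq_zero_of_smul.mp (h c hc) x hx

theorem SymmAlgebra.torsion_eq_bot_iff {R E : Type} [CommRing R] [AddCommGroup E] [Module R E]
    {n s : ℕ} (φ : Matrix (Fin n) (Fin s) R) (g : (Fin n → R) →ₗ[R] E)
    (hg : Function.Surjective g) (hker : LinearMap.ker g = LinearMap.range φ.mulVecLin) :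
    Submodule.torsion R (SymmAlgebra R E) = ⊥ ↔ ∀ c ∈ nonZeroDivisors R,
      IsSMulRegular (MvPolynomial (Fin n) R ⧸ Ideal.span (Set.range φ.linForm))
        (C c : MvPolynomial (Fin n) R) := by
  obtain ⟨ε⟩ := SymmAlgebra.nonempty_algEquiv φ g hg hker
  rw [Submodule.torsion_eq_bot_iff_forall_isSMulRegular]
  refine forall₂_congr fun c _ ↦ ?_
  rw [ε.toLinearEquiv.isSMulRegular_congr c]
  rw [isSMulRegular_iff_right_eq_zero_of_smul, isSMulRegular_iff_right_eq_zero_of_smul]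
  refine forall_congr' fun m ↦ ?_
  rw [← MvPolynomial.algebraMap_eq, algebraMap_smul]

end

section

open MvPolynomial

theorem idealHeight_le_height {R : Type} [CommRing R] {I p : Ideal R} [hp : p.IsPrime]
    (h : I ≤ p) : idealHeight I ≤ p.height := by
  have := PrimeSpectrum.height_eq_orderHeight (⟨p, hp⟩ : PrimeSpectrum R)
  rw [this]
  exact iInf₂_le (⟨p, hp⟩ : PrimeSpectrum R) h

theorem UnmixedRegular.isSMulRegular_of_le_idealHeight {R : Type} [CommRing R]
    [IsNoetherianRing R] (hR : UnmixedRegular R) {e s : ℕ}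
    (φ : Matrix (Fin (s + e)) (Fin s) R)
    (h : ∀ i : ℕ, e ≤ i → ((i - e + 2 : ℕ) : ℕ∞) ≤ idealHeight (minorsIdeal φ (s + e - i)))
    {c : R} (hc : c ∈ nonZeroDivisors R) :
    IsSMulRegular (MvPolynomial (Fin (s + e)) R ⧸ Ideal.span (Set.range φ.linForm))
      (C c : MvPolynomial (Fin (s + e)) R) := by
  have key (Q : Ideal (MvPolynomial (Fin (s + e)) R)) (hQ : Q.IsPrime)
      (hJ : Ideal.span (Set.range φ.linForm) ≤ Q) :
      (s : ℕ∞) ≤ Q.height ∧ (C c ∈ Q → ((s + 1 : ℕ) : ℕ∞) ≤ Q.height) := by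
    have hl (j) : φ.linForm j ∈ Q := hJ (Ideal.subset_span ⟨j, rfl⟩)
    have hp : (Q.comap C).IsPrime := Ideal.comap_isPrime _ _
    by_cases hle : minorsIdeal φ s ≤ Q.comap C
    · obtain ⟨r, hr, h1, h2⟩ := exists_lt_minorsIdeal_le φ hp.ne_top hle
      obtain ⟨f, g, hδ⟩ := exists_det_submatrix_notMem φ h1
      have h3 := φ.height_comap_C_add_le Q hl f g hδ
      have h4 := h (s + e - (r + 1)) (by omega)
      rw [show s + e - (s + e - (r + 1)) = r + 1 by omega] at h4
      have h5 : ((s + 1 : ℕ) : ℕ∞) ≤ Q.height := by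
        refine le_trans ?_ ((add_le_add_left (h4.trans (idealHeight_le_height h2)) _).trans h3)
        norm_cast
        omega
      exact ⟨le_trans (by norm_cast; omega) h5, fun _ ↦ h5⟩
    · obtain ⟨f, g, hδ⟩ := exists_det_submatrix_notMem φ hle
      have h3 := φ.height_comap_C_add_le Q hl f g hδ
      refine ⟨le_add_self.trans h3, fun hcQ ↦ le_trans ?_ h3⟩
      have h4 : 1 ≤ (Q.comap C).height :=
        (Ideal.one_le_height_span_singleton_of_mem_nonZeroDivisors hc).trans
          (Ideal.height_mono ((Ideal.span_singleton_le_iff_mem _).mpr hcQ))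
      rw [Nat.cast_add, add_comm, Nat.cast_one]
      gcongr
  by_contra hn
  have h1 := biUnion_associatedPrimes_eq_compl_regular (MvPolynomial (Fin (s + e)) R)
    (MvPolynomial (Fin (s + e)) R ⧸ Ideal.span (Set.range φ.linForm))
  have h2 : (C c : MvPolynomial (Fin (s + e)) R) ∈ ⋃ p ∈ associatedPrimes
      (MvPolynomial (Fin (s + e)) R)
      (MvPolynomial (Fin (s + e)) R ⧸ Ideal.span (Set.range φ.linForm)),
      (p : Set (MvPolynomial (Fin (s + e)) R)) := by
    rw [h1]
    exact hn
  simp only [Set.mem_iUnion] at h2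
  obtain ⟨P, hP, hcP⟩ := h2
  have hJP : Ideal.span (Set.range φ.linForm) ≤ P := by
    have := IsAssociatedPrime.annihilator_le hP
    rwa [Submodule.annihilator_top, Ideal.annihilator_quotient] at this
  have h3 := (hR.mvPolynomial _).height_le_of_mem_associatedPrimes φ.linForm
    (fun Q hQ hle ↦ (key Q hQ hle).1) hP
  have h4 := ((key P hP.1 hJP).2 hcP).trans h3
  norm_cast at h4
  omega

theorem le_idealHeight_of_forall_isSMulRegular {R : Type} [CommRing R] [IsNoetherianRing R]
    {e s : ℕ} (φ : Matrix (Fin (s + e)) (Fin s) R) (hinj : Function.Injective φ.mulVecLin)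
    (h : ∀ c ∈ nonZeroDivisors R,
      IsSMulRegular (MvPolynomial (Fin (s + e)) R ⧸ Ideal.span (Set.range φ.linForm))
        (C c : MvPolynomial (Fin (s + e)) R)) {i : ℕ} (hi : e ≤ i) :
    ((i - e + 2 : ℕ) : ℕ∞) ≤ idealHeight (minorsIdeal φ (s + e - i)) := by
  refine le_iInf₂ fun x hx ↦ ?_
  rw [← PrimeSpectrum.height_eq_orderHeight]
  generalize hxp : x.asIdeal = p at hx
  have hp : p.IsPrime := hxp ▸ x.2
  obtain ⟨r, hr, h1, h2⟩ := exists_lt_minorsIdeal_le φ hp.ne_top hx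
  obtain ⟨f, g, hδ⟩ := exists_det_submatrix_notMem φ h1
  obtain ⟨P, hP, hPp, hl, hht⟩ := φ.exists_isPrime_linForm_mem p f g hδ h2
  obtain ⟨c, hcI, hc⟩ := exists_mem_minorsIdeal_mem_nonZeroDivisors φ hinj
  have hJP : Ideal.span (Set.range φ.linForm) ≤ P := by
    refine Ideal.span_le.mpr ?_
    rintro _ ⟨j, rfl⟩
    exact hl j
  obtain ⟨Q, hQ, hQP⟩ := Ideal.exists_minimalPrimes_le hJP
  have hQprime : Q.IsPrime := hQ.1.1
  have hQass : Q ∈ associatedPrimes (MvPolynomial (Fin (s + e)) R)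
      (MvPolynomial (Fin (s + e)) R ⧸ Ideal.span (Set.range φ.linForm)) := by
    apply Module.associatedPrimes.minimalPrimes_annihilator_subset_associatedPrimes
    rwa [Ideal.annihilator_quotient]
  have hcQ : C c ∉ Q := fun hmem ↦ IsAssociatedPrime.not_isSMulRegular hQass hmem (h c hc)
  have hcP : C c ∈ P := by
    rw [← Ideal.mem_comap, hPp]
    exact hx (minorsIdeal_antitone φ (by omega) hcI)
  obtain ⟨f', g', hδ'⟩ := exists_det_submatrix_notMem φ
    (I := Q.comap C) (t := s) fun hle ↦ hcQ (hle hcI)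
  have h3 := φ.height_comap_C_add_le Q (fun j ↦ hQ.1.2 (Ideal.subset_span ⟨j, rfl⟩)) f' g' hδ'
  have h4 := Ideal.height_add_one_le_of_lt_of_isPrime
    (SetLike.lt_iff_le_and_exists.mpr ⟨hQP, C c, hcP, hcQ⟩ : Q < P)
  have h5 : ((s + 1 : ℕ) : ℕ∞) ≤ p.height + r := by
    refine le_trans ?_ (h4.trans hht)
    rw [Nat.cast_add, Nat.cast_one]
    gcongr
    exact le_add_self.trans h3
  by_contra! hlt
  have hfin : p.height ≠ ⊤ := hlt.ne_top
  lift p.height to ℕ using hfin with k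
  norm_cast at h5 hlt
  omega

end

/-- For a module of projective dimension at most one over a Cohen-Macaulay local ring,
condition `F_1` holds if and only if the module is of linear type, i.e. its symmetric
algebra is `R`-torsion-free. -/
theorem F1_iff_linearType (R E : Type) [CommRing R] [IsLocalRing R]
    [IsNoetherianRing R] (hCM : IsCohenMacaulayLocalRing R)
    [AddCommGroup E] [Module R E] [Module.Finite R E]
    (e : ℕ) (hrk : hasRank R E e)
    (n s : ℕ) (φ : Matrix (Fin n) (Fin s) R) (g : (Fin n → R) →ₗ[R] E)
    (hg : Function.Surjective g)
    (hker : LinearMap.ker g = LinearMap.range φ.mulVecLin)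
    (hinj : Function.Injective φ.mulVecLin) :
    (∀ i : ℕ, e ≤ i → ((i - e + 2 : ℕ) : ℕ∞) ≤ idealHeight (minorsIdeal φ (n - i))) ↔
    Submodule.torsion R (SymmAlgebra R E) = ⊥ := by
  obtain rfl := hrk.eq_add hinj hg (LinearMap.exact_iff.mpr hker)
  rw [SymmAlgebra.torsion_eq_bot_iff φ g hg hker]
  exact ⟨fun h c hc ↦ hCM.unmixedRegular.isSMulRegular_of_le_idealHeight φ h hc,
    fun h i hi ↦ le_idealHeight_of_forall_isSMulRegular φ hinj h hi⟩
end
end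

section
/- Let k be a field of characteristic zero and R = k[X_1,...,X_n]/I a positively graded k-algebra of dimension d ≥ 2, where I is generated by a homogeneous regular sequence f_1,...,f_{n−d} contained in (X_1,...,X_n)². Let θ be the n × (n−d) matrix (∂f_j/∂x_i) over R, let t = n − 2d + 1 ≥ 1, and let θ' be the submatrix of θ consisting of the last t rows. If I_t(θ) = I_t(θ'), then ht I_t(θ) < d. -/
noncomputable section

/-- `x` is a nonzerodivisor modulo the ideal `a`. -/
def RegularMod {A : Type} [CommRing A] (a : Ideal A) (x : A) : Prop :=
  ∀ u, x * u ∈ a → u ∈ a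

/-- `K` contains an `(A ⧸ a)`-regular sequence (in the weak sense) of length `d`. -/
def HasGrade {A : Type} [CommRing A] (K : Ideal A) : ℕ → Ideal A → Prop
  | 0, _ => True
  | d + 1, a => ∃ x ∈ K, RegularMod a x ∧ HasGrade K d (a ⊔ Ideal.span {x})

section Grade

variable {A : Type} [CommRing A]

lemma RegularMod.pow {a : Ideal A} {x : A} (h : RegularMod a x) (N : ℕ) :
    RegularMod a (x ^ N) := by
  induction N with
  | zero => intro u hu; simpa using hu
  | succ N ih =>
    intro u hu
    exact h u (ih _ (by rwa [← mul_assoc, ← pow_succ]))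

lemma mem_sup_span_singleton' {a : Ideal A} {x u : A} :
    u ∈ a ⊔ Ideal.span {x} ↔ ∃ v, u - x * v ∈ a := by
  rw [sup_comm, Ideal.mem_span_singleton_sup]
  constructor
  · rintro ⟨v, b, hb, rfl⟩
    exact ⟨v, by convert hb using 1; ring⟩
  · rintro ⟨v, hv⟩
    exact ⟨v, _, hv, by ring⟩

lemma RegularMod.swap {a : Ideal A} {y z : A} (hy : RegularMod a y)
    (hz : RegularMod (a ⊔ Ideal.span {y}) z) : RegularMod (a ⊔ Ideal.span {z}) y := by
  intro u hu
  obtain ⟨v, hv⟩ := mem_sup_span_singleton'.1 hu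
  have h1 : v ∈ a ⊔ Ideal.span {y} := hz v (mem_sup_span_singleton'.2 ⟨u, by
    rw [← neg_mem_iff]; convert hv using 1; ring⟩)
  obtain ⟨w, hw⟩ := mem_sup_span_singleton'.1 h1
  refine mem_sup_span_singleton'.2 ⟨w, hy _ ?_⟩
  convert a.add_mem hv (a.mul_mem_left z hw) using 1
  ring

lemma exists_annihilator_of_not_regular [IsNoetherianRing A] {ι : Type} [Finite ι]
    (K : Ideal A) (a : ι → Ideal A) (h : ∀ z ∈ K, ∃ i, ¬ RegularMod (a i) z) :
    ∃ i, ∃ u ∉ a i, ∀ z ∈ K, z * u ∈ a i := by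
  have hfin : (⋃ i, associatedPrimes A (A ⧸ a i)).Finite :=
    Set.finite_iUnion fun i => associatedPrimes.finite A (A ⧸ a i)
  have hsub : (K : Set A) ⊆ ⋃ p ∈ (⋃ i, associatedPrimes A (A ⧸ a i)), (id p : Ideal A) := by
    intro z hz
    obtain ⟨i, hi⟩ := h z hz
    simp only [RegularMod, not_forall] at hi
    obtain ⟨u, hu, hu'⟩ := hi
    have : z ∈ ⋃ p ∈ associatedPrimes A (A ⧸ a i), (p : Set A) := by
      rw [biUnion_associatedPrimes_eq_zero_divisors]
      refine ⟨Ideal.Quotient.mk _ u, fun h0 => hu' (Ideal.Quotient.eq_zero_iff_mem.1 h0), ?_⟩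
      rw [Algebra.smul_def, Ideal.Quotient.algebraMap_eq, ← map_mul]
      exact Ideal.Quotient.eq_zero_iff_mem.2 hu
    simp only [Set.mem_iUnion] at this ⊢
    obtain ⟨p, hp, hzp⟩ := this
    exact ⟨p, ⟨i, hp⟩, hzp⟩
  obtain ⟨p, hp, hKp⟩ := (Ideal.subset_union_prime_finite hfin (f := id) 0 0 (by
    intro p hp _ _
    obtain ⟨i, hi⟩ := Set.mem_iUnion.1 hp
    exact hi.isPrime)).1 hsub
  obtain ⟨i, hi⟩ := Set.mem_iUnion.1 hp
  obtain ⟨_, x, hx⟩ := (isAssociatedPrime_iff).1 hi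
  obtain ⟨u, rfl⟩ := Ideal.Quotient.mk_surjective x
  have key : ∀ z, z ∈ p → z * u ∈ a i := by
    intro z hz
    rw [hx] at hz
    have h0 : z • (Ideal.Quotient.mk (a i) u) = 0 := by simpa using hz
    rw [Algebra.smul_def, Ideal.Quotient.algebraMap_eq, ← map_mul] at h0
    exact Ideal.Quotient.eq_zero_iff_mem.1 h0
  refine ⟨i, u, fun hu => ?_, fun z hz => key z (hKp hz)⟩
  have h1 : (1 : A) ∈ p := by
    rw [hx]
    simp [Ideal.Quotient.eq_zero_iff_mem.2 hu]
  exact hi.isPrime.ne_top ((Ideal.eq_top_iff_one p).2 h1)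

lemma HasGrade.exchange [IsNoetherianRing A] {K : Ideal A} (d : ℕ) :
    ∀ {a : Ideal A} {x : A}, HasGrade K (d + 1) a → x ∈ K → RegularMod a x →
      HasGrade K d (a ⊔ Ideal.span {x}) := by
  induction d with
  | zero => intros; trivial
  | succ d ih =>
    intro a x h hxK hx
    obtain ⟨y, hyK, hy, hG⟩ := h
    obtain ⟨y', hy'K, hy', -⟩ := id hG
    obtain ⟨z, hzK, hz⟩ : ∃ z ∈ K, ∀ i : Fin 3,
        RegularMod (![a, a ⊔ Ideal.span {x}, a ⊔ Ideal.span {y}] i) z := by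
      by_contra! hcon
      obtain ⟨i, u, hu, hKu⟩ := exists_annihilator_of_not_regular K _ hcon
      fin_cases i
      · exact hu (hx u (hKu x hxK))
      · obtain ⟨v, hv⟩ := mem_sup_span_singleton'.1 (hKu y hyK)
        have hv1 : v ∈ a ⊔ Ideal.span {y} := by
          refine hy' v (mem_sup_span_singleton'.2 ?_)
          obtain ⟨w, hw⟩ := mem_sup_span_singleton'.1 (hKu y' hy'K)
          refine ⟨w, hx _ ?_⟩
          convert a.sub_mem (a.mul_mem_left y hw) (a.mul_mem_left y' hv) using 1
          ring
        obtain ⟨w, hw⟩ := mem_sup_span_singleton'.1 hv1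
        refine hu (mem_sup_span_singleton'.2 ⟨w, hy _ ?_⟩)
        convert a.add_mem hv (a.mul_mem_left x hw) using 1
        ring
      · exact hu (hy' u (hKu y' hy'K))
    have h0 : RegularMod a z := hz 0
    have h1 : RegularMod (a ⊔ Ideal.span {x}) z := hz 1
    have h2 : RegularMod (a ⊔ Ideal.span {y}) z := hz 2
    have hyz : HasGrade K (d + 1) (a ⊔ Ideal.span {z}) :=
      ⟨y, hyK, hy.swap h2, by rw [sup_right_comm]; exact ih hG hzK h2⟩
    exact ⟨z, hzK, h1, by rw [sup_right_comm]; exact ih hyz hxK (hx.swap h1)⟩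

lemma HasGrade.ofList [IsNoetherianRing A] {K : Ideal A} (l : List A) :
    ∀ {a : Ideal A} (d : ℕ), HasGrade K (d + l.length) a → (∀ x ∈ l, x ∈ K) →
      (∀ i (h : i < l.length), RegularMod (a ⊔ Ideal.ofList (l.take i)) l[i]) →
      HasGrade K d (a ⊔ Ideal.ofList l) := by
  induction l with
  | nil => intro a d h _ _; simpa using h
  | cons x l ih =>
    intro a d h hK hreg
    rw [Ideal.ofList_cons, ← sup_assoc]
    refine ih d (HasGrade.exchange _ h (hK x (by simp)) ?_) (fun y hy => hK y (by simp [hy])) ?_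
    · have := hreg 0 (by simp)
      rw [List.take_zero, Ideal.ofList_nil, sup_bot_eq] at this
      exact this
    · intro i hi
      have := hreg (i + 1) (by simpa using hi)
      simpa [Ideal.ofList_cons, sup_assoc] using this

lemma regularMod_of_isSMulRegular {l : List A} {x : A}
    (h : IsSMulRegular (A ⧸ (Ideal.ofList l • ⊤ : Submodule A A)) x) :
    RegularMod (Ideal.ofList l) x := by
  intro u hu
  have h0 := @h (Submodule.Quotient.mk u) 0 (by
    simp only [smul_zero]
    rw [← Submodule.Quotient.mk_smul, Submodule.Quotient.mk_eq_zero]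
    simpa using hu)
  rw [Submodule.Quotient.mk_eq_zero] at h0
  simpa using h0

lemma RegularMod.map_localization {L : Type} [CommRing L] [Algebra A L] (M : Submonoid A)
    [IsLocalization M L] {a : Ideal A} {x : A} (h : RegularMod a x) :
    RegularMod (a.map (algebraMap A L)) (algebraMap A L x) := by
  intro u hu
  obtain ⟨⟨b, s⟩, hb⟩ := IsLocalization.surj M u
  obtain ⟨⟨c, t⟩, hc⟩ := (IsLocalization.mem_map_algebraMap_iff M L).1 hu
  have h1 : algebraMap A L (x * b * t) = algebraMap A L (s * c) := by
    simp only [map_mul] at hb hc ⊢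
    rw [← hb, ← hc]
    ring
  obtain ⟨r, hr⟩ := (IsLocalization.eq_iff_exists M L).1 h1
  refine (IsLocalization.mem_map_algebraMap_iff M L).2
    ⟨(⟨r * t * b, h _ ?_⟩, r * t * s), ?_⟩
  · have : x * (r * t * b) = r * s * c := by
      linear_combination hr
    rw [this]
    exact a.mul_mem_left _ c.2
  · simp only [Submonoid.coe_mul, map_mul] at hb ⊢
    rw [← hb]
    ring

lemma HasGrade.map_localization {L : Type} [CommRing L] [Algebra A L] (M : Submonoid A)
    [IsLocalization M L] {K : Ideal A} (d : ℕ) : ∀ {a : Ideal A}, HasGrade K d a →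
      HasGrade (K.map (algebraMap A L)) d (a.map (algebraMap A L)) := by
  induction d with
  | zero => intros; trivial
  | succ d ih =>
    rintro a ⟨x, hxK, hx, h⟩
    refine ⟨_, Ideal.mem_map_of_mem _ hxK, hx.map_localization M, ?_⟩
    simpa [Ideal.map_sup, Ideal.map_span] using ih h

open MvPolynomial in
lemma regularMod_X {k σ : Type} [Field k] (s : Set σ) (i : σ) (hi : i ∉ s) :
    RegularMod (Ideal.span (X '' s : Set (MvPolynomial σ k))) (X i) := by
  intro u hu
  rw [mem_ideal_span_X_image] at hu ⊢
  intro m hm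
  classical
  obtain ⟨j, hj, hmj⟩ := hu (Finsupp.single i 1 + m) (by
    rw [support_X_mul]
    exact Finset.mem_map.2 ⟨m, hm, rfl⟩)
  refine ⟨j, hj, ?_⟩
  have : i ≠ j := fun h => hi (h ▸ hj)
  simpa [Finsupp.single_apply, this] using hmj

open MvPolynomial in
lemma hasGrade_X {k : Type} [Field k] (n : ℕ) :
    HasGrade (Ideal.span (Set.range (X : Fin n → MvPolynomial (Fin n) k))) n ⊥ := by
  have key : ∀ d (hd : d ≤ n), HasGrade
      (Ideal.span (Set.range (X : Fin n → MvPolynomial (Fin n) k)))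
      d (Ideal.span (X '' {i : Fin n | (i : ℕ) < n - d})) := by
    intro d
    induction d with
    | zero => intros; trivial
    | succ d ih =>
      intro hd
      refine ⟨X ⟨n - (d + 1), by omega⟩, Ideal.subset_span ⟨_, rfl⟩, regularMod_X _ _ (by simp), ?_⟩
      convert ih (by omega) using 1
      rw [← Ideal.span_union]
      congr 1
      rw [← Set.image_singleton, ← Set.image_union]
      congr 1
      ext i
      simp [Fin.ext_iff]
      omega
  convert key n le_rfl
  simp

end Grade

section Exterior

variable {A : Type} [CommRing A] {M : Type} [AddCommGroup M] [Module A M]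

/-- Contraction of the exterior algebra by a linear functional. -/
def contr (φ : Module.Dual A M) : ExteriorAlgebra A M →ₗ[A] ExteriorAlgebra A M :=
  CliffordAlgebra.contractLeft (Q := (0 : QuadraticForm A M)) φ

lemma contr_ι_mul (φ : Module.Dual A M) (v : M) (y : ExteriorAlgebra A M) :
    contr φ (ExteriorAlgebra.ι A v * y) = φ v • y - ExteriorAlgebra.ι A v * contr φ y :=
  CliffordAlgebra.contractLeft_ι_mul φ v y

lemma contr_self (φ : Module.Dual A M) (y : ExteriorAlgebra A M) : contr φ (contr φ y) = 0 :=
  CliffordAlgebra.contractLeft_contractLeft φ y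

lemma contr_comm (φ ψ : Module.Dual A M) (y : ExteriorAlgebra A M) :
    contr φ (contr ψ y) = -contr ψ (contr φ y) :=
  CliffordAlgebra.contractLeft_comm φ ψ y

lemma contr_ι (φ : Module.Dual A M) (v : M) :
    contr φ (ExteriorAlgebra.ι A v) = algebraMap A _ (φ v) :=
  CliffordAlgebra.contractLeft_ι 0 φ v

lemma contr_one (φ : Module.Dual A M) : contr φ 1 = 0 :=
  CliffordAlgebra.contractLeft_one 0 φ

lemma contr_add (φ ψ : Module.Dual A M) : contr (φ + ψ) = contr φ + contr ψ :=
  map_add (CliffordAlgebra.contractLeft (Q := (0 : QuadraticForm A M))) φ ψ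

lemma contr_smul (c : A) (φ : Module.Dual A M) : contr (c • φ) = c • contr φ :=
  map_smul (CliffordAlgebra.contractLeft (Q := (0 : QuadraticForm A M))) c φ

lemma contr_sum {κ : Type} (s : Finset κ) (φ : κ → Module.Dual A M) :
    contr (∑ i ∈ s, φ i) = ∑ i ∈ s, contr (φ i) :=
  map_sum (CliffordAlgebra.contractLeft (Q := (0 : QuadraticForm A M))) φ s

lemma ι_mul_mem (v : M) {p : ℕ} {y : ExteriorAlgebra A M} (hy : y ∈ ⋀[A]^p M) :
    ExteriorAlgebra.ι A v * y ∈ ⋀[A]^(p + 1) M := by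
  rw [ExteriorAlgebra.exteriorPower, pow_succ']
  exact Submodule.mul_mem_mul ⟨v, rfl⟩ hy

lemma contr_eq_zero_of_mem_zero (φ : Module.Dual A M) {y : ExteriorAlgebra A M}
    (hy : y ∈ ⋀[A]^0 M) : contr φ y = 0 := by
  rw [ExteriorAlgebra.exteriorPower, pow_zero] at hy
  obtain ⟨c, rfl⟩ := Submodule.mem_one.1 hy
  rw [Algebra.algebraMap_eq_smul_one, map_smul, contr_one, smul_zero]

lemma contr_mem (φ : Module.Dual A M) (p : ℕ) :
    ∀ {y : ExteriorAlgebra A M}, y ∈ ⋀[A]^(p + 1) M → contr φ y ∈ ⋀[A]^p M := by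
  induction p with
  | zero =>
    intro y hy
    rw [ExteriorAlgebra.exteriorPower, pow_succ'] at hy
    induction hy using Submodule.mul_induction_on' with
    | mem_mul_mem v hv y hy =>
      obtain ⟨v, rfl⟩ := hv
      rw [contr_ι_mul, contr_eq_zero_of_mem_zero φ hy, mul_zero, sub_zero]
      exact Submodule.smul_mem _ _ hy
    | add x _ y _ hx hy => rw [map_add]; exact add_mem hx hy
  | succ p ih =>
    intro y hy
    rw [ExteriorAlgebra.exteriorPower, pow_succ'] at hy
    induction hy using Submodule.mul_induction_on' with
    | mem_mul_mem v hv y hy =>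
      obtain ⟨v, rfl⟩ := hv
      rw [contr_ι_mul]
      exact sub_mem (Submodule.smul_mem _ _ hy) (ι_mul_mem v (ih hy))
    | add x _ y _ hx hy => rw [map_add]; exact add_mem hx hy

lemma map_mem_smul {N : Type} [AddCommGroup N] [Module A N] (f : N →ₗ[A] N) {P P' : Submodule A N}
    (hf : ∀ x ∈ P, f x ∈ P') (a : Ideal A) {x : N} (hx : x ∈ a • P) : f x ∈ a • P' := by
  have : f x ∈ (a • P).map f := ⟨x, hx, rfl⟩
  rw [Submodule.map_smul''] at this
  exact Submodule.smul_mono le_rfl (Submodule.map_le_iff_le_comap.2 hf) this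

lemma contr_mem_smul (φ : Module.Dual A M) (a : Ideal A) {p : ℕ} {y : ExteriorAlgebra A M}
    (hy : y ∈ a • ⋀[A]^(p + 1) M) : contr φ y ∈ a • ⋀[A]^p M :=
  map_mem_smul (contr φ) (fun _ => contr_mem φ p) a hy

lemma ι_mul_mem_smul (v : M) (a : Ideal A) {p : ℕ} {y : ExteriorAlgebra A M}
    (hy : y ∈ a • ⋀[A]^p M) : ExteriorAlgebra.ι A v * y ∈ a • ⋀[A]^(p + 1) M :=
  map_mem_smul (LinearMap.mulLeft A (ExteriorAlgebra.ι A v)) (fun _ => ι_mul_mem v) a hy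

/-- Successive contraction by the functionals of a list. -/
def contrList : List (Module.Dual A M) → ExteriorAlgebra A M →ₗ[A] ExteriorAlgebra A M
  | [] => LinearMap.id
  | φ :: l => contrList l ∘ₗ contr φ

lemma contrList_cons (φ : Module.Dual A M) (l : List (Module.Dual A M))
    (y : ExteriorAlgebra A M) : contrList (φ :: l) y = contrList l (contr φ y) := rfl

lemma contrList_mem_smul (a : Ideal A) (l : List (Module.Dual A M)) :
    ∀ {p : ℕ} {y : ExteriorAlgebra A M}, y ∈ a • ⋀[A]^(p + l.length) M →
      contrList l y ∈ a • ⋀[A]^p M := by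
  induction l with
  | nil => intro p y hy; exact hy
  | cons φ l ih => intro p y hy; exact ih (contr_mem_smul φ a hy)

lemma contrList_contr_of_mem {l : List (Module.Dual A M)} {φ : Module.Dual A M} (h : φ ∈ l)
    (y : ExteriorAlgebra A M) : contrList l (contr φ y) = 0 := by
  induction l generalizing y with
  | nil => simp at h
  | cons ψ l ih =>
    rw [contrList_cons]
    rcases List.mem_cons.1 h with rfl | h
    · rw [contr_self, map_zero]
    · rw [contr_comm, map_neg, ih h, neg_zero]

lemma contr_ιMulti (φ : Module.Dual A M) (t : ℕ) : ∀ v : Fin (t + 1) → M,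
    contr φ (ExteriorAlgebra.ιMulti A (t + 1) v) =
      ∑ j : Fin (t + 1), ((-1) ^ (j : ℕ) * φ (v j)) •
        ExteriorAlgebra.ιMulti A t (v ∘ j.succAbove) := by
  induction t with
  | zero =>
    intro v
    simp [ExteriorAlgebra.ιMulti_succ_apply, contr_ι, Algebra.algebraMap_eq_smul_one]
  | succ t ih =>
    intro v
    rw [ExteriorAlgebra.ιMulti_succ_apply, contr_ι_mul, ih, Finset.mul_sum,
      Fin.sum_univ_succ (n := t + 1),
      sub_eq_add_neg, ← Finset.sum_neg_distrib]
    congr 1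
    · simp only [Fin.val_zero, pow_zero, one_mul]
      rfl
    · refine Finset.sum_congr rfl fun j _ => ?_
      rw [ExteriorAlgebra.ιMulti_succ_apply, mul_smul_comm, ← neg_smul]
      have htail : Matrix.vecTail (v ∘ j.succ.succAbove) = Matrix.vecTail v ∘ j.succAbove := by
        funext i
        simp [Matrix.vecTail]
      rw [htail]
      congr 1
      simp [pow_succ, Matrix.vecTail]

lemma contrList_ιMulti (t : ℕ) : ∀ (φ : Fin t → Module.Dual A M) (v : Fin t → M),
    contrList (List.ofFn φ) (ExteriorAlgebra.ιMulti A t v) =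
      algebraMap A _ (Matrix.det (Matrix.of fun i j => φ i (v j))) := by
  induction t with
  | zero => intro φ v; simp [contrList]
  | succ t ih =>
    intro φ v
    rw [List.ofFn_succ, contrList_cons, contr_ιMulti, map_sum, Matrix.det_succ_row_zero, map_sum]
    refine Finset.sum_congr rfl fun j _ => ?_
    rw [map_smul, ih, Algebra.smul_def, ← map_mul]
    rfl

end Exterior

section EagonNorthcott

variable {A : Type} [CommRing A] {M : Type} [AddCommGroup M] [Module A M] {t : ℕ}

/-- Families of exterior forms indexed by (inverse) monomials in `t` variables such that the
component at a monomial `α` has exterior degree `p + |α|` and coefficients in the ideal `a`, and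
vanishes if `|α| < j`. -/
def strand (M : Type) [AddCommGroup M] [Module A M] (t : ℕ) (a : Ideal A) (p j : ℕ) :
    Submodule A ((Fin t → ℕ) → ExteriorAlgebra A M) where
  carrier := {z | ∀ α, z α ∈ a • ⋀[A]^(p + ∑ i, α i) M ∧ (∑ i, α i < j → z α = 0)}
  add_mem' := by
    intro x y hx hy α
    refine ⟨Submodule.add_mem _ (hx α).1 (hy α).1, fun h => ?_⟩
    rw [Pi.add_apply, (hx α).2 h, (hy α).2 h, add_zero]
  zero_mem' := fun α => ⟨Submodule.zero_mem _, fun _ => rfl⟩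
  smul_mem' := by
    intro c x hx α
    refine ⟨Submodule.smul_mem _ c (hx α).1, fun h => ?_⟩
    rw [Pi.smul_apply, (hx α).2 h, smul_zero]

lemma strand_mono {a b : Ideal A} (hab : a ≤ b) {p j j' : ℕ} (hj : j' ≤ j) :
    strand M t a p j ≤ strand M t b p j' := fun _ hz α =>
  ⟨Submodule.smul_mono_left hab (hz α).1, fun h => (hz α).2 (by omega)⟩

lemma sum_add_single (α : Fin t → ℕ) (r : Fin t) :
    ∑ i, (α + Pi.single r 1 : Fin t → ℕ) i = ∑ i, α i + 1 := by
  simp [Finset.sum_add_distrib]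

lemma sub_single_add_single {α : Fin t → ℕ} {r : Fin t} (h : α r ≠ 0) :
    α - Pi.single r 1 + Pi.single r 1 = α := by
  funext i
  rcases eq_or_ne i r with rfl | hi
  · simp; omega
  · simp [hi]

lemma add_single_sub_single (α : Fin t → ℕ) {r s : Fin t} (h : α r ≠ 0) :
    α + Pi.single s 1 - Pi.single r 1 = α - Pi.single r 1 + Pi.single s 1 := by
  funext i
  rcases eq_or_ne i r with rfl | hi
  · simp; omega
  · simp [hi]

/-- The differential of the Koszul complex of the linear forms attached to the functionals `θ`,
acting on inverse polynomials. -/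
def koszul (θ : Fin t → Module.Dual A M) :
    ((Fin t → ℕ) → ExteriorAlgebra A M) →ₗ[A] ((Fin t → ℕ) → ExteriorAlgebra A M) where
  toFun z α := ∑ r, contr (θ r) (z (α + Pi.single r 1))
  map_add' x y := by funext α; simp [Finset.sum_add_distrib]
  map_smul' c x := by funext α; simp [Finset.smul_sum]

lemma koszul_apply (θ : Fin t → Module.Dual A M) (z : (Fin t → ℕ) → ExteriorAlgebra A M)
    (α : Fin t → ℕ) : koszul θ z α = ∑ r, contr (θ r) (z (α + Pi.single r 1)) := rfl

lemma koszul_koszul (θ : Fin t → Module.Dual A M) (z : (Fin t → ℕ) → ExteriorAlgebra A M) :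
    koszul θ (koszul θ z) = 0 := by
  funext α
  simp only [koszul_apply, map_sum, Pi.zero_apply]
  rw [← Finset.sum_product']
  refine Finset.sum_involution (fun x _ => (x.2, x.1)) ?_ ?_ (by simp) (by simp)
  · rintro ⟨r, s⟩ _
    dsimp only
    rw [contr_comm, add_right_comm α, neg_add_cancel]
  · rintro ⟨r, s⟩ _ h0 heq
    obtain rfl : s = r := congrArg Prod.fst heq
    exact h0 (contr_self _ _)

lemma koszul_mem (θ : Fin t → Module.Dual A M) {a : Ideal A} {p j : ℕ}
    {z : (Fin t → ℕ) → ExteriorAlgebra A M} (hz : z ∈ strand M t a p (j + 1)) :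
    koszul θ z ∈ strand M t a p j := by
  intro α
  constructor
  · rw [koszul_apply]
    refine Submodule.sum_mem _ fun r _ => contr_mem_smul _ _ ?_
    have := (hz (α + Pi.single r 1)).1
    rwa [sum_add_single, ← add_assoc] at this
  · intro h
    rw [koszul_apply]
    refine Finset.sum_eq_zero fun r _ => ?_
    rw [(hz (α + Pi.single r 1)).2 (by rw [sum_add_single]; omega), map_zero]

lemma koszul_mem_zero (θ : Fin t → Module.Dual A M) {a : Ideal A} {p : ℕ}
    {z : (Fin t → ℕ) → ExteriorAlgebra A M} (hz : z ∈ strand M t a p 0) :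
    koszul θ z ∈ strand M t a p 0 := by
  intro α
  rw [koszul_apply]
  refine ⟨Submodule.sum_mem _ fun r _ => contr_mem_smul _ _ ?_, by simp⟩
  have := (hz (α + Pi.single r 1)).1
  rwa [sum_add_single, ← add_assoc] at this

/-- Multiplication by the vector `v` and division by the `r`-th variable. -/
def raise (v : M) (r : Fin t) :
    ((Fin t → ℕ) → ExteriorAlgebra A M) →ₗ[A] ((Fin t → ℕ) → ExteriorAlgebra A M) where
  toFun z α := if α r = 0 then 0 else ExteriorAlgebra.ι A v * z (α - Pi.single r 1)
  map_add' x y := by funext α; by_cases h : α r = 0 <;> simp [h, mul_add]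
  map_smul' c x := by funext α; by_cases h : α r = 0 <;> simp [h]

lemma raise_apply (v : M) (r : Fin t) (z : (Fin t → ℕ) → ExteriorAlgebra A M) (α : Fin t → ℕ) :
    raise v r z α =
      if α r = 0 then 0 else ExteriorAlgebra.ι A v * z (α - Pi.single r 1) := rfl

lemma raise_mem (v : M) (r : Fin t) {a : Ideal A} {p j : ℕ}
    {z : (Fin t → ℕ) → ExteriorAlgebra A M} (hz : z ∈ strand M t a p j) :
    raise v r z ∈ strand M t a p (j + 1) := by
  intro α
  rw [raise_apply]
  split_ifs with h
  · simp
  · have hsum : ∑ i, α i = ∑ i, (α - Pi.single r 1 : Fin t → ℕ) i + 1 := by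
      rw [← sum_add_single, sub_single_add_single h]
    constructor
    · rw [hsum, ← add_assoc]
      exact ι_mul_mem_smul v a (hz _).1
    · intro hlt
      rw [(hz (α - Pi.single r 1)).2 (by omega), mul_zero]

/-- The discrepancy between `koszul θ` and `raise v r` being a contracting homotopy. -/
def corner (θ : Fin t → Module.Dual A M) (ψ : Fin t → M) (r : Fin t)
    (z : (Fin t → ℕ) → ExteriorAlgebra A M) : (Fin t → ℕ) → ExteriorAlgebra A M :=
  fun α => if α r = 0 then ExteriorAlgebra.ι A (ψ r) * contr (θ r) (z α) else 0

lemma koszul_raise {θ : Fin t → Module.Dual A M} {ψ : Fin t → M} {c : A}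
    (h : ∀ s r, θ s (ψ r) = if s = r then c else 0) (r : Fin t)
    (z : (Fin t → ℕ) → ExteriorAlgebra A M) :
    koszul θ (raise (ψ r) r z) + raise (ψ r) r (koszul θ z) + corner θ ψ r z = c • z := by
  funext α
  have hr : contr (θ r) (raise (ψ r) r z (α + Pi.single r 1)) =
      c • z α - ExteriorAlgebra.ι A (ψ r) * contr (θ r) (z α) := by
    rw [raise_apply, if_neg (by simp), contr_ι_mul, h, if_pos rfl, add_tsub_cancel_right]
  simp only [Pi.add_apply, Pi.smul_apply, koszul_apply]
  rw [← Finset.add_sum_erase _ _ (Finset.mem_univ r), hr, raise_apply]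
  by_cases h0 : α r = 0
  · rw [if_pos h0, Finset.sum_eq_zero, corner, if_pos h0]
    · abel
    · intro s hs
      have hsr : s ≠ r := Finset.ne_of_mem_erase hs
      rw [raise_apply, if_pos (by simp [h0, hsr.symm]), map_zero]
  · rw [if_neg h0, corner, if_neg h0, koszul_apply, ← Finset.add_sum_erase _ _ (Finset.mem_univ r),
      sub_single_add_single h0, mul_add, Finset.mul_sum]
    have : ∑ s ∈ Finset.univ.erase r, contr (θ s) (raise (ψ r) r z (α + Pi.single s 1)) =
        -∑ s ∈ Finset.univ.erase r, ExteriorAlgebra.ι A (ψ r) *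
          contr (θ s) (z (α - Pi.single r 1 + Pi.single s 1)) := by
      rw [← Finset.sum_neg_distrib]
      refine Finset.sum_congr rfl fun s hs => ?_
      have hsr : s ≠ r := Finset.ne_of_mem_erase hs
      rw [raise_apply, if_neg (by simp [h0]), contr_ι_mul, h, if_neg hsr, zero_smul, zero_sub,
        add_single_sub_single α h0]
    rw [this]
    abel

/-- Contract by `θ r` and multiply by `ψ r`, successively for the `r` in a list. -/
def sweep (θ : Fin t → Module.Dual A M) (ψ : Fin t → M) (l : List (Fin t))
    (y : ExteriorAlgebra A M) : ExteriorAlgebra A M :=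
  l.foldr (fun r y => ExteriorAlgebra.ι A (ψ r) * contr (θ r) y) y

lemma sweep_cons (θ : Fin t → Module.Dual A M) (ψ : Fin t → M) (r : Fin t) (l : List (Fin t))
    (y : ExteriorAlgebra A M) :
    sweep θ ψ (r :: l) y = ExteriorAlgebra.ι A (ψ r) * contr (θ r) (sweep θ ψ l y) := rfl

lemma contr_sweep {θ : Fin t → Module.Dual A M} {ψ : Fin t → M} {c : A}
    (h : ∀ s r, θ s (ψ r) = if s = r then c else 0) {s : Fin t} {l : List (Fin t)} (hs : s ∉ l)
    (y : ExteriorAlgebra A M) : contr (θ s) (sweep θ ψ l y) = sweep θ ψ l (contr (θ s) y) := by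
  induction l with
  | nil => rfl
  | cons r l ih =>
    obtain ⟨hsr, hsl⟩ := List.ne_and_not_mem_of_not_mem_cons hs
    rw [sweep_cons, contr_ι_mul, h, if_neg hsr, zero_smul, zero_sub, contr_comm, mul_neg, neg_neg,
      ih hsl, sweep_cons]

lemma sweep_mem {θ : Fin t → Module.Dual A M} {ψ : Fin t → M} {c : A}
    (h : ∀ s r, θ s (ψ r) = if s = r then c else 0) {a : Ideal A} {p : ℕ} {l : List (Fin t)}
    (hl : l.Nodup) : ∀ {y : ExteriorAlgebra A M}, contrList (l.map θ) y ∈ a • ⋀[A]^p M →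
      sweep θ ψ l y ∈ a • ⋀[A]^(p + l.length) M := by
  induction l with
  | nil => intro y hy; exact hy
  | cons r l ih =>
    intro y hy
    rw [sweep_cons, contr_sweep h (List.nodup_cons.1 hl).1]
    exact ι_mul_mem_smul _ a (ih (List.nodup_cons.1 hl).2 hy)

lemma foldr_corner_apply (θ : Fin t → Module.Dual A M) (ψ : Fin t → M) (l : List (Fin t))
    (z : (Fin t → ℕ) → ExteriorAlgebra A M) (α : Fin t → ℕ) :
    l.foldr (corner θ ψ) z α = if ∀ r ∈ l, α r = 0 then sweep θ ψ l (z α) else 0 := by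
  induction l with
  | nil => simp [sweep]
  | cons r l ih =>
    rw [List.foldr_cons, corner, ih]
    by_cases h0 : α r = 0
    · by_cases h1 : ∀ r ∈ l, α r = 0
      · rw [if_pos h0, if_pos h1, if_pos (List.forall_mem_cons (p := fun r => α r = 0).2 ⟨h0, h1⟩),
          sweep_cons]
      · rw [if_pos h0, if_neg h1, if_neg (fun h => h1 fun s hs => h s (List.mem_cons_of_mem _ hs)),
          map_zero,
          mul_zero]
    · rw [if_neg h0, if_neg (fun h => h0 (h r List.mem_cons_self))]

lemma ι_mul_contr_mem (v : M) (φ : Module.Dual A M) {p : ℕ} {y : ExteriorAlgebra A M}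
    (hy : y ∈ (⊤ : Ideal A) • ⋀[A]^p M) :
    ExteriorAlgebra.ι A v * contr φ y ∈ (⊤ : Ideal A) • ⋀[A]^p M := by
  cases p with
  | zero =>
    rw [Submodule.top_smul] at hy
    rw [contr_eq_zero_of_mem_zero φ hy, mul_zero]
    exact Submodule.zero_mem _
  | succ p => exact ι_mul_mem_smul v ⊤ (contr_mem_smul φ ⊤ hy)

lemma pow_smul_sub_foldr_corner {θ : Fin t → Module.Dual A M} {ψ : Fin t → M} {c : A}
    (h : ∀ s r, θ s (ψ r) = if s = r then c else 0) {a : Ideal A} {p j : ℕ}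
    {z : (Fin t → ℕ) → ExteriorAlgebra A M} (hz : z ∈ strand M t ⊤ p j)
    (hcyc : koszul θ z ∈ strand M t a p 0) (l : List (Fin t)) :
    l.foldr (corner θ ψ) z ∈ strand M t ⊤ p j ∧
    koszul θ (l.foldr (corner θ ψ) z) ∈ strand M t a p 0 ∧
    ∃ w ∈ strand M t ⊤ p (j + 1),
      c ^ l.length • z - l.foldr (corner θ ψ) z - koszul θ w ∈ strand M t a p 0 := by
  induction l with
  | nil => exact ⟨hz, hcyc, 0, zero_mem _, by simp⟩
  | cons r l ih =>
    obtain ⟨hmem, hker, w, hw, hwz⟩ := ih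
    set y := l.foldr (corner θ ψ) z with hy
    have hid : corner θ ψ r y =
        c • y - koszul θ (raise (ψ r) r y) - raise (ψ r) r (koszul θ y) := by
      rw [← koszul_raise h r y]; abel
    have hrk : raise (ψ r) r (koszul θ y) ∈ strand M t a p 0 :=
      strand_mono le_rfl (Nat.zero_le 1) (raise_mem _ _ hker)
    rw [List.foldr_cons, ← hy, List.length_cons]
    refine ⟨?_, ?_, c • w + raise (ψ r) r y,
      add_mem (Submodule.smul_mem _ _ hw) (raise_mem _ _ hmem), ?_⟩
    · intro α
      unfold corner
      split_ifs
      · constructor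
        · exact ι_mul_contr_mem _ _ (hmem α).1
        · intro hlt
          rw [(hmem α).2 hlt, map_zero, mul_zero]
      · simp
    · rw [hid, map_sub, map_sub, map_smul, koszul_koszul, sub_zero]
      exact sub_mem (Submodule.smul_mem _ _ hker) (koszul_mem_zero θ hrk)
    · rw [hid, map_add, map_smul]
      have : c ^ (l.length + 1) • z -
          (c • y - koszul θ (raise (ψ r) r y) - raise (ψ r) r (koszul θ y)) -
          (c • koszul θ w + koszul θ (raise (ψ r) r y)) =
          c • (c ^ l.length • z - y - koszul θ w) + raise (ψ r) r (koszul θ y) := by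
        rw [pow_succ', mul_smul, smul_sub, smul_sub]; abel
      rw [this]
      exact add_mem (Submodule.smul_mem _ _ hwz) hrk

/-- The cycle condition of the Eagon-Northcott complex of `θ` modulo the ideal `a`; in the lowest
degree it involves the augmentation by the maximal minors. -/
def IsCycleMod (θ : Fin t → Module.Dual A M) (a : Ideal A) (j : ℕ)
    (z : (Fin t → ℕ) → ExteriorAlgebra A M) : Prop :=
  koszul θ z ∈ strand M t a t 0 ∧ (j = 0 → contrList (List.ofFn θ) (z 0) ∈ a • ⋀[A]^0 M)

lemma exists_koszul_of_scalar {θ : Fin t → Module.Dual A M} {ψ : Fin t → M} {c : A}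
    (h : ∀ s r, θ s (ψ r) = if s = r then c else 0) {a : Ideal A} {j : ℕ}
    {z : (Fin t → ℕ) → ExteriorAlgebra A M} (hz : z ∈ strand M t ⊤ t j)
    (hcyc : IsCycleMod θ a j z) :
    ∃ w ∈ strand M t ⊤ t (j + 1), c ^ t • z - koszul θ w ∈ strand M t a t 0 := by
  obtain ⟨-, -, w, hw, hwz⟩ := pow_smul_sub_foldr_corner h hz hcyc.1 (List.finRange t)
  rw [List.length_finRange] at hwz
  refine ⟨w, hw, ?_⟩
  have hlast : (List.finRange t).foldr (corner θ ψ) z ∈ strand M t a t 0 := by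
    intro α
    refine ⟨?_, by simp⟩
    rw [foldr_corner_apply]
    split_ifs with hα
    · obtain rfl : α = 0 := funext fun r => hα r (List.mem_finRange r)
      rcases Nat.eq_zero_or_pos j with rfl | hj
      · have h1 := sweep_mem h (a := a) (p := 0) (List.nodup_finRange t) (y := z 0)
          (by rw [← List.ofFn_eq_map]; exact hcyc.2 rfl)
        simpa using h1
      · rw [(hz 0).2 (by simpa using hj)]
        have : ∀ l, sweep θ ψ l (0 : ExteriorAlgebra A M) = 0 := by
          intro l
          induction l with
          | nil => rfl
          | cons r l ih => rw [sweep_cons, ih, map_zero, mul_zero]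
        rw [this]
        exact zero_mem _
    · exact zero_mem _
  have := add_mem hwz hlast
  convert this using 1
  abel

end EagonNorthcott

section Acyclicity

variable {A : Type} [CommRing A] {M : Type} [AddCommGroup M] [Module A M] {t : ℕ}

lemma mem_smul_of_regularMod {N : Type} [AddCommGroup N] [Module A N] (P : Submodule A N)
    [Module.Free A P] {a : Ideal A} {x : A} (hx : RegularMod a x) {y : N} (hy : y ∈ P)
    (hxy : x • y ∈ a • P) : y ∈ a • P := by
  have key : ∀ w : P, w ∈ a • (⊤ : Submodule A P) ↔
      ∀ i, (Module.Free.chooseBasis A P).repr w i ∈ a := by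
    intro w
    constructor
    · intro hw i
      have h1 : (Module.Free.chooseBasis A P).coord i w ∈
          (a • (⊤ : Submodule A P)).map ((Module.Free.chooseBasis A P).coord i) := ⟨w, hw, rfl⟩
      rw [Submodule.map_smul''] at h1
      exact (Submodule.smul_le.2 fun r hr s _ => Ideal.mul_mem_right _ _ hr :
        a • (⊤ : Submodule A P).map ((Module.Free.chooseBasis A P).coord i) ≤ a) h1
    · intro hw
      rw [← (Module.Free.chooseBasis A P).linearCombination_repr w,
        Finsupp.linearCombination_apply]
      exact Submodule.sum_mem _ fun i _ => Submodule.smul_mem_smul (hw i) trivial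
  have h1 := (Submodule.mem_smul_top_iff a P (x • (⟨y, hy⟩ : P))).2 hxy
  refine (Submodule.mem_smul_top_iff a P ⟨y, hy⟩).1 ((key _).2 fun i => hx _ ?_)
  have := (key _).1 h1 i
  rwa [map_smul, Finsupp.smul_apply, smul_eq_mul] at this

lemma eq_zero_of_mem_exteriorPower {m p : ℕ} (b : Module.Basis (Fin m) A M) (hp : m < p)
    {y : ExteriorAlgebra A M} (hy : y ∈ ⋀[A]^p M) : y = 0 := by
  have : IsEmpty (Set.powersetCard (Fin m) p) := by
    refine ⟨fun s => ?_⟩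
    have h1 := s.2
    have h2 := Finset.card_le_univ (s : Finset (Fin m))
    rw [Fintype.card_fin] at h2
    have h3 : (s : Finset (Fin m)).card = p := h1
    omega
  have h : (⟨y, hy⟩ : ⋀[A]^p M) = 0 := (b.exteriorPower p).ext_elem fun i => isEmptyElim i
  exact congrArg Subtype.val h

lemma smul_mem_strand {a : Ideal A} {p j : ℕ} {z : (Fin t → ℕ) → ExteriorAlgebra A M}
    (hz : z ∈ strand M t ⊤ p j) {c : A} (hc : c ∈ a) : c • z ∈ strand M t a p j := by
  intro α
  refine ⟨?_, fun h => by rw [Pi.smul_apply, (hz α).2 h, smul_zero]⟩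
  have := (hz α).1
  rw [Submodule.top_smul] at this
  exact Submodule.smul_mem_smul hc this

lemma mem_strand_of_regularMod {m : ℕ} (b : Module.Basis (Fin m) A M) {a : Ideal A} {p : ℕ} {c : A}
    (hc : RegularMod a c) {z : (Fin t → ℕ) → ExteriorAlgebra A M} (hz : z ∈ strand M t ⊤ p 0)
    (hcz : c • z ∈ strand M t a p 0) : z ∈ strand M t a p 0 := by
  have := Module.Free.of_basis b
  intro α
  refine ⟨mem_smul_of_regularMod _ hc ?_ (hcz α).1, by simp⟩
  have := (hz α).1
  rwa [Submodule.top_smul] at this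

lemma exists_sub_smul_mem_strand {a : Ideal A} {c : A} {p j : ℕ}
    {z : (Fin t → ℕ) → ExteriorAlgebra A M} (hz : z ∈ strand M t (a ⊔ Ideal.span {c}) p j) :
    ∃ u ∈ strand M t ⊤ p j, z - c • u ∈ strand M t a p j := by
  have h : ∀ α, ∃ u : ExteriorAlgebra A M, (u ∈ ⋀[A]^(p + ∑ i, α i) M ∧ (∑ i, α i < j → u = 0)) ∧
      z α - c • u ∈ a • ⋀[A]^(p + ∑ i, α i) M := by
    intro α
    by_cases hj : ∑ i, α i < j
    · refine ⟨0, ⟨Submodule.zero_mem _, fun _ => rfl⟩, ?_⟩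
      rw [(hz α).2 hj, smul_zero, sub_zero]
      exact Submodule.zero_mem _
    · have h1 := (hz α).1
      rw [Submodule.sup_smul, Submodule.ideal_span_singleton_smul] at h1
      obtain ⟨y, hy, y', hy', hyy⟩ := Submodule.mem_sup.1 h1
      obtain ⟨u, hu, rfl⟩ := (Submodule.mem_smul_pointwise_iff_exists _ _ _).1 hy'
      exact ⟨u, ⟨hu, fun h => absurd h hj⟩, by rwa [← hyy, add_sub_cancel_right]⟩
  choose u hu hzu using h
  refine ⟨u, fun α => ⟨by rw [Submodule.top_smul]; exact (hu α).1, (hu α).2⟩, fun α =>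
    ⟨hzu α, fun hj => ?_⟩⟩
  rw [Pi.sub_apply, Pi.smul_apply, (hz α).2 hj, (hu α).2 hj, smul_zero, sub_zero]

lemma exists_scalar (θ : Fin t → Module.Dual A M) (v : Fin t → M) :
    ∃ ψ : Fin t → M, ∀ s r, θ s (ψ r) =
      if s = r then (Matrix.of fun i j => θ i (v j)).det else 0 := by
  refine ⟨fun r => ∑ j, (Matrix.of fun i j => θ i (v j)).adjugate j r • v j, fun s r => ?_⟩
  have := congrFun (congrFun (Matrix.mul_adjugate (Matrix.of fun i j => θ i (v j))) s) r
  rw [Matrix.mul_apply, Matrix.smul_apply, Matrix.one_apply, smul_eq_mul, mul_ite,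
    mul_one, mul_zero] at this
  rw [map_sum, ← this]
  refine Finset.sum_congr rfl fun j _ => ?_
  rw [map_smul, smul_eq_mul, mul_comm, Matrix.of_apply]

/-- The ideal of maximal minors of a family of functionals. -/
def maxMinors (θ : Fin t → Module.Dual A M) : Ideal A :=
  Ideal.span (Set.range fun v : Fin t → M => (Matrix.of fun i j => θ i (v j)).det)

theorem exists_koszul_of_isCycleMod [IsNoetherianRing A] {m : ℕ} (b : Module.Basis (Fin m) A M)
    (θ : Fin t → Module.Dual A M) {K a₀ : Ideal A} (hK : K ≤ (maxMinors θ ⊔ a₀).radical) (d : ℕ) :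
    ∀ {a : Ideal A} {j : ℕ} {z : (Fin t → ℕ) → ExteriorAlgebra A M}, a₀ ≤ a → HasGrade K d a →
      m + 1 ≤ t + j + d → z ∈ strand M t ⊤ t j → IsCycleMod θ a j z →
      ∃ u ∈ strand M t ⊤ t (j + 1), z - koszul θ u ∈ strand M t a t 0 := by
  induction d with
  | zero =>
    intro a j z _ _ hm hz _
    refine ⟨0, Submodule.zero_mem _, ?_⟩
    have : z = 0 := by
      funext α
      by_cases hj : ∑ i, α i < j
      · exact (hz α).2 hj
      · have h1 := (hz α).1
        rw [Submodule.top_smul] at h1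
        exact eq_zero_of_mem_exteriorPower b (by omega) h1
    rw [this, map_zero, sub_zero]
    exact Submodule.zero_mem _
  | succ d ih =>
    intro a j z ha hG hm hz hcyc
    obtain ⟨x, hxK, hx, -⟩ := id hG
    set J : Ideal A := ((strand M t ⊤ t (j + 1)).map (koszul θ) ⊔ strand M t a t 0).comap
      (LinearMap.toSpanSingleton A _ z) with hJ
    have mem_J : ∀ c w, w ∈ strand M t ⊤ t (j + 1) → c • z - koszul θ w ∈ strand M t a t 0 →
        c ∈ J := fun c w hw hcw =>
      Submodule.mem_sup.2 ⟨_, ⟨w, hw, rfl⟩, _, hcw, by simp⟩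
    have hxJ : x ∈ J.radical := by
      have h1 : maxMinors θ ⊔ a₀ ≤ J.radical := by
        refine sup_le (Ideal.span_le.2 ?_) ?_
        · rintro _ ⟨v, rfl⟩
          obtain ⟨ψ, hψ⟩ := exists_scalar θ v
          obtain ⟨w, hw, hcw⟩ := exists_koszul_of_scalar hψ hz hcyc
          exact ⟨t, mem_J _ w hw hcw⟩
        · intro c hc
          refine Ideal.le_radical (mem_J c 0 (Submodule.zero_mem _) ?_)
          rw [map_zero, sub_zero]
          exact strand_mono le_rfl (Nat.zero_le j) (smul_mem_strand hz (ha hc))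
      exact (Ideal.radical_mono h1).trans J.radical_idem.le (hK hxK)
    obtain ⟨N, hN⟩ := hxJ
    set c := x ^ (N + 1) with hc
    have hcJ : c ∈ J := by rw [hc, pow_succ]; exact J.mul_mem_right _ hN
    have hcK : c ∈ K := by rw [hc, pow_succ]; exact K.mul_mem_left _ hxK
    have hca : RegularMod a c := hx.pow _
    obtain ⟨_, ⟨w, hw, rfl⟩, e, he, hwe⟩ := Submodule.mem_sup.1 hcJ
    rw [LinearMap.toSpanSingleton_apply] at hwe
    have hle : a ≤ a ⊔ Ideal.span {c} := le_sup_left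
    have hcs : c ∈ a ⊔ Ideal.span {c} :=
      Ideal.mem_sup_right (Ideal.mem_span_singleton_self c)
    have hwcyc : IsCycleMod θ (a ⊔ Ideal.span {c}) (j + 1) w := by
      refine ⟨?_, fun h => absurd h (by omega)⟩
      rw [eq_sub_of_add_eq hwe]
      exact Submodule.sub_mem _ (strand_mono le_rfl (Nat.zero_le j) (smul_mem_strand hz hcs))
        (strand_mono hle le_rfl he)
    obtain ⟨v, hv, hwv⟩ := ih (ha.trans hle) (hG.exchange d hcK hca) (by omega) hw hwcyc
    have hwv' : w - koszul θ v ∈ strand M t (a ⊔ Ideal.span {c}) t (j + 1) := fun α =>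
      ⟨(hwv α).1, (Submodule.sub_mem _ hw (koszul_mem θ hv) α).2⟩
    obtain ⟨u, hu, hwu⟩ := exists_sub_smul_mem_strand hwv'
    refine ⟨u, hu, mem_strand_of_regularMod b hca (Submodule.sub_mem _
      (strand_mono le_rfl (Nat.zero_le j) hz)
      (strand_mono le_rfl (Nat.zero_le j) (koszul_mem θ hu))) ?_⟩
    have hk : c • (z - koszul θ u) = e + koszul θ (w - koszul θ v - c • u) := by
      rw [map_sub, map_sub, koszul_koszul, map_smul, smul_sub, ← hwe]
      abel
    rw [hk]
    exact Submodule.add_mem _ he (strand_mono le_rfl (Nat.zero_le j) (koszul_mem θ hwu))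

end Acyclicity

section SpecialRow

variable {A : Type} [CommRing A] {M : Type} [AddCommGroup M] [Module A M] {t : ℕ}

lemma exists_contr_of_contrList_mem [IsNoetherianRing A] {m : ℕ} (b : Module.Basis (Fin m) A M)
    (θ : Fin t → Module.Dual A M) {K a : Ideal A} (hK : K ≤ (maxMinors θ ⊔ a).radical) {d : ℕ}
    (hG : HasGrade K d a) (hm : m + 1 ≤ t + d) {y : ExteriorAlgebra A M} (hy : y ∈ ⋀[A]^t M)
    (hya : contrList (List.ofFn θ) y ∈ a • ⋀[A]^0 M) :
    ∃ u : Fin t → ExteriorAlgebra A M, y - ∑ r, contr (θ r) (u r) ∈ a • ⋀[A]^t M := by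
  have hz : (Pi.single 0 y : (Fin t → ℕ) → ExteriorAlgebra A M) ∈ strand M t ⊤ t 0 := by
    intro α
    refine ⟨?_, by simp⟩
    rw [Submodule.top_smul]
    rcases eq_or_ne α 0 with rfl | hα
    · simpa using hy
    · rw [Pi.single_eq_of_ne hα]
      exact Submodule.zero_mem _
  have hk : koszul θ (Pi.single 0 y) = 0 := by
    funext α
    rw [koszul_apply]
    refine Finset.sum_eq_zero fun r _ => ?_
    rw [Pi.single_eq_of_ne, map_zero]
    intro h
    simpa using congrFun h r
  obtain ⟨u, -, hu⟩ := exists_koszul_of_isCycleMod b θ hK d le_rfl hG (j := 0) (by omega) hz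
    ⟨by rw [hk]; exact Submodule.zero_mem _, fun _ => by rwa [Pi.single_eq_same]⟩
  refine ⟨fun r => u (0 + Pi.single r 1), ?_⟩
  have := (hu 0).1
  simpa only [Pi.sub_apply, Pi.single_eq_same, koszul_apply, Pi.zero_apply,
    Finset.sum_const_zero, add_zero] using this

lemma contr_mem_of_forall_mem {m : ℕ} (b : Module.Basis (Fin m) A M) {φ : Module.Dual A M}
    {a : Ideal A} (hφ : ∀ v, φ v ∈ a) {P P' : Submodule A (ExteriorAlgebra A M)}
    (hP : ∀ ψ : Module.Dual A M, ∀ y ∈ P, contr ψ y ∈ P') {y : ExteriorAlgebra A M} (hy : y ∈ P) :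
    contr φ y ∈ a • P' := by
  rw [← b.sum_dual_apply_smul_coord φ, contr_sum, LinearMap.sum_apply]
  refine Submodule.sum_mem _ fun i _ => ?_
  rw [contr_smul, LinearMap.smul_apply]
  exact Submodule.smul_mem_smul (hφ _) (hP _ _ hy)

lemma contrList_mem_map_sup {θ θ' : Fin t → Module.Dual A M} {a : Ideal A}
    (h : ∀ v : Fin t → M, (Matrix.of fun i j => θ' i (v j)).det ∈ maxMinors θ ⊔ a)
    {y : ExteriorAlgebra A M} (hy : y ∈ ⋀[A]^t M) :
    contrList (List.ofFn θ') y ∈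
      (⋀[A]^t M).map (contrList (List.ofFn θ)) ⊔ a • ⋀[A]^0 M := by
  suffices hs : ⋀[A]^t M ≤ ((⋀[A]^t M).map (contrList (List.ofFn θ)) ⊔ a • ⋀[A]^0 M).comap
      (contrList (List.ofFn θ')) from hs hy
  have hle : maxMinors θ ⊔ a ≤ ((⋀[A]^t M).map (contrList (List.ofFn θ)) ⊔
      a • ⋀[A]^0 M).comap (Algebra.linearMap A (ExteriorAlgebra A M)) := by
    refine sup_le (Ideal.span_le.2 ?_) fun c hc => ?_
    · rintro _ ⟨v, rfl⟩
      refine Submodule.mem_sup_left ⟨ExteriorAlgebra.ιMulti A t v,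
        ExteriorAlgebra.ιMulti_range A t ⟨v, rfl⟩, ?_⟩
      rw [contrList_ιMulti, Algebra.linearMap_apply]
    · refine Submodule.mem_sup_right ?_
      rw [Algebra.linearMap_apply, Algebra.algebraMap_eq_smul_one]
      refine Submodule.smul_mem_smul hc ?_
      rw [ExteriorAlgebra.exteriorPower, pow_zero]
      exact Submodule.one_le.1 le_rfl
  rw [← ExteriorAlgebra.ιMulti_span_fixedDegree, Submodule.span_le]
  rintro _ ⟨v, rfl⟩
  have := hle (h v)
  rwa [Submodule.mem_comap, Algebra.linearMap_apply, ← contrList_ιMulti,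
    ← ExteriorAlgebra.ιMulti_span_fixedDegree] at this

lemma exists_contrList_mem {ι : Type} [Fintype ι] {m : ℕ} (b : Module.Basis (Fin m) A M)
    (Θ : ι → Module.Dual A M) {σ : Fin (t + 1) → ι} {a : Ideal A}
    {c : ι → A} (hc : ∀ v, ∑ i, c i * Θ i v ∈ a)
    (hminor : ∀ (g : Fin (t + 1) → ι) (v : Fin (t + 1) → M),
      (Matrix.of fun i j => Θ (g i) (v j)).det ∈ maxMinors (fun r => Θ (σ r)) ⊔ a)
    {y : ExteriorAlgebra A M} (hy : y ∈ ⋀[A]^(t + 1) M) :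
    ∃ w : ι → ExteriorAlgebra A M, (∀ i, w i ∈ ⋀[A]^(t + 1) M) ∧ (∀ r, w (σ r) = 0) ∧
      contrList (List.ofFn fun r => Θ (σ r)) (c (σ 0) • y + ∑ i, c i • w i) ∈ a • ⋀[A]^0 M := by
  classical
  set tl : List (Module.Dual A M) := List.ofFn fun r : Fin t => Θ (σ r.succ) with htl
  have hlen : tl.length = t := by rw [htl, List.length_ofFn]
  have hcons : List.ofFn (fun r => Θ (σ r)) = Θ (σ 0) :: tl := List.ofFn_succ
  have hw : ∀ i, ∃ w ∈ ⋀[A]^(t + 1) M, ((∃ r, σ r = i) → w = 0) ∧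
      (if i = σ 0 then 0 else contrList tl (contr (Θ i) y)) -
        contrList (List.ofFn fun r => Θ (σ r)) w ∈ a • ⋀[A]^0 M := by
    intro i
    by_cases hi : ∃ r, σ r = i
    · refine ⟨0, Submodule.zero_mem _, fun _ => rfl, ?_⟩
      obtain ⟨r, rfl⟩ := hi
      rw [map_zero, sub_zero]
      split_ifs with h
      · exact Submodule.zero_mem _
      · have hr : r ≠ 0 := fun h' => h (by rw [h'])
        rw [contrList_contr_of_mem]
        · exact Submodule.zero_mem _
        · rw [htl, List.mem_ofFn]
          exact ⟨r.pred hr, by simp⟩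
    · have h1 := contrList_mem_map_sup (θ := fun r => Θ (σ r))
        (θ' := fun r => Θ ((Fin.cons i (fun r : Fin t => σ r.succ) : Fin (t + 1) → ι) r)) (a := a)
        (fun v => hminor _ v) hy
      obtain ⟨_, ⟨w, hw, rfl⟩, e, he, hwe⟩ := Submodule.mem_sup.1 h1
      refine ⟨w, hw, fun h => absurd h hi, ?_⟩
      rw [if_neg (fun h => hi ⟨0, h.symm⟩)]
      have h2 : contrList (List.ofFn fun r => Θ ((Fin.cons i (fun r : Fin t => σ r.succ) :
          Fin (t + 1) → ι) r)) y = contrList tl (contr (Θ i) y) := by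
        rw [List.ofFn_succ, contrList_cons]
        rfl
      rw [← h2, ← hwe, add_sub_cancel_left]
      exact he
  choose w hw hw0 hwa using hw
  refine ⟨w, hw, fun r => hw0 _ ⟨r, rfl⟩, ?_⟩
  have heuler : contrList tl (contr (∑ i, c i • Θ i) y) ∈ a • ⋀[A]^0 M := by
    refine contrList_mem_smul a tl ?_
    rw [hlen, Nat.zero_add]
    refine contr_mem_of_forall_mem b (fun v => ?_) (fun ψ y hy => contr_mem ψ t hy) hy
    simpa [LinearMap.sum_apply] using hc v
  have hsum : contrList tl (contr (∑ i, c i • Θ i) y) =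
      c (σ 0) • contrList (List.ofFn fun r => Θ (σ r)) y +
        ∑ i, c i • (if i = σ 0 then 0 else contrList tl (contr (Θ i) y)) := by
    rw [contr_sum, LinearMap.sum_apply, map_sum, ← Finset.add_sum_erase _ _ (Finset.mem_univ (σ 0)),
      ← Finset.add_sum_erase _ _ (Finset.mem_univ (σ 0)), if_pos rfl, smul_zero, zero_add,
      contr_smul, LinearMap.smul_apply, map_smul, hcons, contrList_cons]
    congr 1
    refine Finset.sum_congr rfl fun i hi => ?_
    rw [if_neg (Finset.ne_of_mem_erase hi), contr_smul, LinearMap.smul_apply, map_smul]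
  have hfin : contrList (List.ofFn fun r => Θ (σ r)) (c (σ 0) • y + ∑ i, c i • w i) =
      contrList tl (contr (∑ i, c i • Θ i) y) -
        ∑ i, c i • ((if i = σ 0 then 0 else contrList tl (contr (Θ i) y)) -
          contrList (List.ofFn fun r => Θ (σ r)) (w i)) := by
    rw [hsum, map_add, map_smul, map_sum]
    simp only [map_smul, smul_sub, Finset.sum_sub_distrib]
    abel
  rw [hfin]
  exact Submodule.sub_mem _ heuler
    (Submodule.sum_mem _ fun i _ => Submodule.smul_mem _ _ (hwa i))

theorem mul_det_mem_of_maxMinors [IsNoetherianRing A] {ι : Type} [Fintype ι] {m : ℕ}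
    (b : Module.Basis (Fin m) A M) (Θ : ι → Module.Dual A M) {σ : Fin (t + 1) → ι}
    {K a Q : Ideal A}
    (hK : K ≤ (maxMinors (fun r => Θ (σ r)) ⊔ a).radical) {d : ℕ} (hG : HasGrade K d a)
    (hm : m ≤ t + d) {c : ι → A} (hc : ∀ v, ∑ i, c i * Θ i v ∈ a)
    (hminor : ∀ (g : Fin (t + 1) → ι) (v : Fin (t + 1) → M),
      (Matrix.of fun i j => Θ (g i) (v j)).det ∈ maxMinors (fun r => Θ (σ r)) ⊔ a)
    (haQ : a ≤ Q) (hcQ : ∀ i, (∀ r, σ r ≠ i) → c i ∈ Q) (φ : Fin (t + 1) → Module.Dual A M)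
    (hφ : ∀ r, ∃ l : Fin (t + 1) → A, ∀ v, Θ (σ r) v - ∑ i, l i * φ i v ∈ Q)
    (v : Fin (t + 1) → M) : c (σ 0) * (Matrix.of fun i j => φ i (v j)).det ∈ Q := by
  set y := ExteriorAlgebra.ιMulti A (t + 1) v with hy
  have hymem : y ∈ ⋀[A]^(t + 1) M := ExteriorAlgebra.ιMulti_range A _ ⟨v, rfl⟩
  obtain ⟨w, hw, hw0, hwa⟩ := exists_contrList_mem b Θ hc hminor hymem
  obtain ⟨u, hu⟩ := exists_contr_of_contrList_mem b _ hK hG (by omega)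
    (Submodule.add_mem _ (Submodule.smul_mem _ _ hymem)
      (Submodule.sum_mem _ fun i _ => Submodule.smul_mem _ _ (hw i))) hwa
  set Ψ : ExteriorAlgebra A M →ₗ[A] A :=
    ExteriorAlgebra.algebraMapInv.toLinearMap ∘ₗ contrList (List.ofFn φ) with hΨ
  have hΨsmul : ∀ {I : Ideal A} {P : Submodule A (ExteriorAlgebra A M)} {x},
      x ∈ I • P → Ψ x ∈ I := by
    intro I P x hx
    have h1 : Ψ x ∈ (I • P).map Ψ := ⟨x, hx, rfl⟩
    rw [Submodule.map_smul''] at h1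
    exact (Submodule.smul_le.2 fun r hr s _ => Ideal.mul_mem_right _ _ hr : I • P.map Ψ ≤ I) h1
  have hΨy : Ψ y = (Matrix.of fun i j => φ i (v j)).det := by
    rw [hΨ, hy, LinearMap.comp_apply, contrList_ιMulti]
    exact ExteriorAlgebra.algebraMap_leftInverse M _
  have hΨθ : ∀ r, Ψ (contr (Θ (σ r)) (u r)) ∈ Q := by
    intro r
    obtain ⟨l, hl⟩ := hφ r
    have h1 : Θ (σ r) = (Θ (σ r) - ∑ i, l i • φ i) + ∑ i, l i • φ i := by abel
    rw [h1, contr_add, LinearMap.add_apply, map_add]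
    have h2 : Ψ (contr (∑ i, l i • φ i) (u r)) = 0 := by
      rw [contr_sum, LinearMap.sum_apply, map_sum]
      refine Finset.sum_eq_zero fun i _ => ?_
      rw [contr_smul, LinearMap.smul_apply, map_smul, hΨ, LinearMap.comp_apply,
        contrList_contr_of_mem (List.mem_ofFn.2 ⟨i, rfl⟩), map_zero, smul_zero]
    rw [h2, add_zero]
    refine hΨsmul (P := ⊤) (contr_mem_of_forall_mem b (P := ⊤) (fun v => ?_) (by simp) trivial)
    simpa [LinearMap.sum_apply] using hl v
  have hmain := haQ (hΨsmul hu)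
  rw [map_sub, map_add, map_smul, map_sum, map_sum, hΨy, smul_eq_mul] at hmain
  have hc' : ∑ i, Ψ (c i • w i) ∈ Q := by
    refine Ideal.sum_mem _ fun i _ => ?_
    rw [map_smul, smul_eq_mul]
    by_cases hi : ∃ r, σ r = i
    · obtain ⟨r, rfl⟩ := hi
      rw [hw0, map_zero, mul_zero]
      exact Q.zero_mem
    · exact Ideal.mul_mem_right _ _ (hcQ i (not_exists.1 hi))
  have := Q.add_mem hmain (Ideal.sum_mem _ fun r (_ : r ∈ Finset.univ) => hΨθ r)
  rw [sub_add_cancel] at this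
  exact (Submodule.add_mem_iff_left Q hc').1 this

end SpecialRow

section DualFamilies

variable {k V : Type} [Field k] [AddCommGroup V] [Module k V] [FiniteDimensional k V]

lemma exists_le_finrank_eq (W : Submodule k V) (s : ℕ) (hV : Module.finrank k W + s ≤
    Module.finrank k V) : ∃ W', W ≤ W' ∧ Module.finrank k W' = Module.finrank k W + s := by
  induction s with
  | zero => exact ⟨W, le_rfl, rfl⟩
  | succ s ih =>
    obtain ⟨W', hle, hW'⟩ := ih (by omega)
    have hne : W' ≠ ⊤ := by
      rintro rfl
      rw [finrank_top] at hW'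
      omega
    obtain ⟨v, hv⟩ := SetLike.exists_not_mem_of_ne_top W' hne rfl
    refine ⟨W' ⊔ Submodule.span k {v}, hle.trans le_sup_left, ?_⟩
    have h1 := Submodule.finrank_add_le_finrank_add_finrank W' (Submodule.span k {v})
    have h2 : Module.finrank k (Submodule.span k {v}) ≤ 1 :=
      (finrank_span_le_card ({v} : Set V)).trans (by simp)
    have h3 : W' < W' ⊔ Submodule.span k {v} := lt_of_le_of_ne le_sup_left fun h =>
      hv (h ▸ Submodule.mem_sup_right (Submodule.mem_span_singleton_self v))
    have h4 := Submodule.finrank_lt_finrank_of_lt h3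
    omega

lemma exists_linearIndependent_of_family {t : ℕ} (u : Fin t → V) (ht : t ≤ Module.finrank k V) :
    ∃ u' : Fin t → V, LinearIndependent k u' ∧ ∀ r, ∃ l : Fin t → k, u r = ∑ i, l i • u' i := by
  have h1 : Module.finrank k (Submodule.span k (Set.range u)) ≤ t := by
    have := finrank_range_le_card (R := k) u
    rwa [Fintype.card_fin] at this
  obtain ⟨W, hle, hW⟩ := exists_le_finrank_eq (Submodule.span k (Set.range u))
    (t - Module.finrank k (Submodule.span k (Set.range u))) (by omega)
  rw [Nat.add_sub_cancel' h1] at hW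
  let b : Module.Basis (Fin t) k W := Module.finBasisOfFinrankEq k W hW
  refine ⟨fun i => b i, b.linearIndependent.map' W.subtype (Submodule.ker_subtype W), fun r =>
    ⟨b.repr ⟨u r, hle (Submodule.subset_span ⟨r, rfl⟩)⟩, ?_⟩⟩
  have := congrArg W.subtype (b.sum_repr ⟨u r, hle (Submodule.subset_span ⟨r, rfl⟩)⟩)
  rw [map_sum] at this
  simpa using this.symm

lemma exists_dual_families {t : ℕ} (φ : Fin t → Module.Dual k V) (ht : t ≤ Module.finrank k V) :
    ∃ (φ' : Fin t → Module.Dual k V) (v : Fin t → V),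
      (∀ i j, φ' i (v j) = if i = j then 1 else 0) ∧
      ∀ r, ∃ l : Fin t → k, φ r = ∑ i, l i • φ' i := by
  obtain ⟨φ', hli, hφ⟩ := exists_linearIndependent_of_family φ (by rwa [Subspace.dual_finrank_eq])
  have hsurj : Function.Surjective (LinearMap.pi φ') := by
    rw [← LinearMap.dualMap_injective_iff, injective_iff_map_eq_zero]
    intro e he
    have h2 : ∑ i, e (Pi.single i 1) • φ' i = 0 := by
      refine LinearMap.ext fun v => ?_
      have h3 : e (LinearMap.pi φ' v) = 0 := LinearMap.congr_fun he v
      rw [LinearMap.pi_apply_eq_sum_univ] at h3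
      rw [LinearMap.sum_apply, LinearMap.zero_apply, ← h3]
      refine Finset.sum_congr rfl fun i _ => ?_
      rw [LinearMap.smul_apply, smul_eq_mul, smul_eq_mul, mul_comm, LinearMap.pi_apply]
      congr 2
      funext j
      simp [Pi.single_apply, eq_comm]
    have h4 := Fintype.linearIndependent_iff.1 hli _ h2
    refine LinearMap.pi_ext' fun i => LinearMap.ext_ring ?_
    simpa using h4 i
  choose v hv using fun j => hsurj (Pi.single j 1)
  refine ⟨φ', v, fun i j => ?_, hφ⟩
  have := congrFun (hv j) i
  simpa [Pi.single_apply] using this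

end DualFamilies

section Minors

variable {A : Type} [CommRing A]

lemma det_mem_of_basis {M κ : Type} [AddCommGroup M] [Module A M] {t : ℕ}
    (b : Module.Basis κ A M) (θ : Fin t → Module.Dual A M) {J : Ideal A}
    (h : ∀ g : Fin t → κ, (Matrix.of fun i j => θ i (b (g j))).det ∈ J) (v : Fin t → M) :
    (Matrix.of fun i j => θ i (v j)).det ∈ J := by
  let D : MultilinearMap A (fun _ : Fin t => M) (A ⧸ J) :=
    J.mkQ.compMultilinearMap
      ((Matrix.detRowAlternating (R := A) (n := Fin t)).compLinearMap
        (LinearMap.pi θ)).toMultilinearMap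
  have hD : ∀ w : Fin t → M, D w = J.mkQ (Matrix.of fun i j => θ i (w j)).det := by
    intro w
    rw [← Matrix.det_transpose]
    rfl
  have h0 : D = 0 := Module.Basis.ext_multilinear (fun _ => b) fun g => by
    rw [hD, zero_apply, Submodule.mkQ_apply, Submodule.Quotient.mk_eq_zero]
    exact h g
  have := hD v
  rw [h0, zero_apply, Submodule.mkQ_apply, eq_comm,
    Submodule.Quotient.mk_eq_zero] at this
  exact this

lemma minorsIdeal_map {R : Type} [CommRing R] {n m : Type} [Fintype n] [Fintype m]
    (π : A →+* R) (M : Matrix n m A) (t : ℕ) :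
    minorsIdeal (M.map π) t = (minorsIdeal M t).map π := by
  unfold minorsIdeal
  rw [Ideal.map_span]
  congr 1
  ext x
  constructor
  · rintro ⟨f, g, rfl⟩
    exact ⟨_, ⟨f, g, rfl⟩, π.map_det _⟩
  · rintro ⟨_, ⟨f, g, rfl⟩, rfl⟩
    exact ⟨f, g, π.map_det _⟩

lemma minorsIdeal_le_of_det_mem {m : Type} [Fintype m] {t : ℕ} (M : Matrix (Fin t) m A)
    {J : Ideal A} (h : ∀ g : Fin t → m, (M.submatrix id g).det ∈ J) : minorsIdeal M t ≤ J := by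
  refine Ideal.span_le.2 ?_
  rintro _ ⟨f, g, rfl⟩
  have : M.submatrix f g = (1 : Matrix (Fin t) (Fin t) A).submatrix f id * M.submatrix id g := by
    ext i j
    simp [Matrix.mul_apply, Matrix.one_apply]
  rw [this, Matrix.det_mul]
  exact J.mul_mem_left _ (h g)

end Minors

section Origin

open MvPolynomial

variable {k : Type} [Field k] {n : ℕ}

lemma mem_idealOfVars_iff {x : MvPolynomial (Fin n) k} :
    x ∈ idealOfVars (Fin n) k ↔ constantCoeff x = 0 := by
  have := mem_pow_idealOfVars_iff' (σ := Fin n) (R := k) 1 x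
  rw [pow_one] at this
  rw [this]
  simp [constantCoeff_eq, Finsupp.degree_eq_zero_iff]

instance isPrime_idealOfVars : (idealOfVars (Fin n) k).IsPrime := by
  have : idealOfVars (Fin n) k = RingHom.ker (constantCoeff (σ := Fin n) (R := k)) := by
    ext x
    rw [mem_idealOfVars_iff, RingHom.mem_ker]
  rw [this]
  exact RingHom.ker_isPrime _

lemma pderiv_mem_idealOfVars {x : MvPolynomial (Fin n) k} (hx : x ∈ idealOfVars (Fin n) k ^ 2)
    (i : Fin n) : pderiv i x ∈ idealOfVars (Fin n) k := by
  rw [pow_two] at hx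
  induction hx using Submodule.mul_induction_on' with
  | mem_mul_mem u hu v hv =>
    rw [Derivation.leibniz]
    exact Ideal.add_mem _ (Ideal.mul_mem_right _ _ hu) (Ideal.mul_mem_right _ _ hv)
  | add u _ v _ hu hv => rw [map_add]; exact Ideal.add_mem _ hu hv

/-- The restriction of polynomials to the first order neighbourhood of the origin on the `s`-th
coordinate axis. -/
def axisJet (k : Type) [Field k] {n : ℕ} (s : Fin n) :
    MvPolynomial (Fin n) k →ₐ[k] DualNumber k :=
  aeval fun i => if i = s then DualNumber.eps else 0

lemma fst_axisJet (s : Fin n) (x : MvPolynomial (Fin n) k) :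
    (axisJet k s x).fst = constantCoeff x := by
  have : (TrivSqZeroExt.fstHom k k k).comp (axisJet k s) = aeval (fun _ => (0 : k)) := by
    refine algHom_ext fun i => ?_
    simp only [AlgHom.comp_apply, axisJet, aeval_X]
    split_ifs <;> simp
  have h1 := DFunLike.congr_fun this x
  rw [AlgHom.comp_apply] at h1
  refine h1.trans ?_
  rw [aeval_zero']
  rfl

lemma axisJet_eq_of_mem (s : Fin n) {x : MvPolynomial (Fin n) k}
    (hx : x ∈ idealOfVars (Fin n) k) :
    axisJet k s x = (axisJet k s x).snd • DualNumber.eps := by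
  ext
  · rw [fst_axisJet, mem_idealOfVars_iff.1 hx]
    simp
  · simp

lemma axisJet_eq_zero (s : Fin n) {x : MvPolynomial (Fin n) k}
    (hx : x ∈ idealOfVars (Fin n) k ^ 2) : axisJet k s x = 0 := by
  rw [pow_two] at hx
  induction hx using Submodule.mul_induction_on' with
  | mem_mul_mem u hu v hv =>
    rw [map_mul, axisJet_eq_of_mem s hu, axisJet_eq_of_mem s hv, smul_mul_smul_comm,
      DualNumber.eps_mul_eps, smul_zero]
  | add u _ v _ hu hv => rw [map_add, hu, hv, add_zero]

/-- The extension of `axisJet` to the local ring at the origin. -/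
def localAxisJet (k : Type) [Field k] {n : ℕ} (s : Fin n) :
    Localization.AtPrime (idealOfVars (Fin n) k) →+* DualNumber k :=
  IsLocalization.lift (M := (idealOfVars (Fin n) k).primeCompl) (g := (axisJet k s).toRingHom)
    fun y => TrivSqZeroExt.isUnit_iff_isUnit_fst.2 <| by
      have h : (axisJet k s y).fst ≠ 0 := by
        rw [fst_axisJet]
        exact fun h => y.2 (mem_idealOfVars_iff.2 h)
      exact h.isUnit

lemma localAxisJet_algebraMap (s : Fin n) (x : MvPolynomial (Fin n) k) :
    localAxisJet k s (algebraMap _ _ x) = axisJet k s x :=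
  IsLocalization.lift_eq _ x

lemma map_le_radical_map {J : Ideal (MvPolynomial (Fin n) k)}
    (hJ : ∀ p : Ideal (MvPolynomial (Fin n) k), p.IsPrime → J ≤ p → p ≤ idealOfVars (Fin n) k →
      p = idealOfVars (Fin n) k) :
    (idealOfVars (Fin n) k).map
        (algebraMap _ (Localization.AtPrime (idealOfVars (Fin n) k))) ≤
      (J.map (algebraMap _ (Localization.AtPrime (idealOfVars (Fin n) k)))).radical := by
  rw [Ideal.radical_eq_sInf]
  refine le_sInf fun q hq => ?_
  obtain ⟨hJq, hqp⟩ := hq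
  rw [Ideal.map_le_iff_le_comap]
  refine (hJ _ (hqp.comap _) (Ideal.map_le_iff_le_comap.1 hJq) ?_).ge
  have h := ((IsLocalization.isPrime_iff_isPrime_disjoint
    (idealOfVars (Fin n) k).primeCompl _ q).1 hqp).2
  intro x hx
  by_contra hx'
  exact Set.disjoint_left.1 h hx' hx

lemma hasGrade_span_range {m d : ℕ} {f : Fin m → MvPolynomial (Fin n) k} (hmd : d + m = n)
    (hreg : RingTheory.Sequence.IsRegular (MvPolynomial (Fin n) k) (List.ofFn f))
    (hf : ∀ j, f j ∈ idealOfVars (Fin n) k) :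
    HasGrade (idealOfVars (Fin n) k) d (Ideal.span (Set.range f)) := by
  have h := HasGrade.ofList (List.ofFn f) (K := idealOfVars (Fin n) k) (a := ⊥) d ?_ ?_ ?_
  · rw [bot_sup_eq] at h
    convert h using 2
    ext x
    simp
  · rw [List.length_ofFn, hmd]
    exact hasGrade_X n
  · intro x hx
    obtain ⟨j, rfl⟩ := List.mem_ofFn.1 hx
    exact hf j
  · intro i hi
    rw [bot_sup_eq]
    exact regularMod_of_isSMulRegular (hreg.regular_mod_prev i hi)

end Origin

lemma eq_of_le_of_le_idealHeight {A : Type} [CommRing A] {F : Ideal A} {I : Ideal (A ⧸ F)} {d : ℕ}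
    (hdim : ringKrullDim (A ⧸ F) = d) (hI : (d : ℕ∞) ≤ idealHeight I) {p q : Ideal A}
    (hp : p.IsPrime) (hq : q.IsPrime) (hpq : p ≤ q) (hF : F ≤ p)
    (hIp : I ≤ p.map (Ideal.Quotient.mk F)) : p = q := by
  by_contra hne
  have hker : ∀ {r : Ideal A}, F ≤ r → RingHom.ker (Ideal.Quotient.mk F) ≤ r := fun h => by
    rwa [Ideal.mk_ker]
  let P : PrimeSpectrum (A ⧸ F) := ⟨p.map (Ideal.Quotient.mk F),
    Ideal.map_isPrime_of_surjective Ideal.Quotient.mk_surjective (hker hF)⟩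
  let Q : PrimeSpectrum (A ⧸ F) := ⟨q.map (Ideal.Quotient.mk F),
    Ideal.map_isPrime_of_surjective Ideal.Quotient.mk_surjective (hker (hF.trans hpq))⟩
  have hPQ : P < Q := by
    refine lt_of_le_of_ne (Ideal.map_mono hpq : P.asIdeal ≤ Q.asIdeal) fun h => hne ?_
    have h1 := congrArg (Ideal.comap (Ideal.Quotient.mk F)) (congrArg PrimeSpectrum.asIdeal h)
    rwa [Ideal.comap_map_of_surjective' _ Ideal.Quotient.mk_surjective,
      Ideal.comap_map_of_surjective' _ Ideal.Quotient.mk_surjective,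
      sup_eq_left.2 (hker hF), sup_eq_left.2 (hker (hF.trans hpq))] at h1
  have h1 : (d : ℕ∞) ≤ Order.height P := hI.trans (iInf₂_le P hIp)
  have h2 : ((d + 1 : ℕ) : ℕ∞) ≤ Order.height Q := by
    rw [Nat.cast_add, Nat.cast_one]
    exact (add_le_add_left h1 1).trans (Order.height_add_one_le hPQ)
  have h3 : ((Order.height Q : ℕ∞) : WithBot ℕ∞) ≤ ((d : ℕ∞) : WithBot ℕ∞) := by
    have := Order.height_le_krullDim Q
    rw [ringKrullDim] at hdim
    rw [hdim] at this
    exact this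
  have h4 := Nat.cast_le.1 (h2.trans (WithBot.coe_le_coe.1 h3))
  omega

/-- The functional on row vectors given by a row of coefficients. -/
def rowDual {A : Type} [CommRing A] {m : ℕ} (r : Fin m → A) : Module.Dual A (Fin m → A) :=
  ∑ j, r j • LinearMap.proj j

lemma rowDual_apply {A : Type} [CommRing A] {m : ℕ} (r v : Fin m → A) :
    rowDual r v = ∑ j, r j * v j := by
  simp [rowDual, LinearMap.sum_apply]

lemma rowDual_basis {A : Type} [CommRing A] {m : ℕ} (r : Fin m → A) (j : Fin m) :
    rowDual r (Pi.basisFun A (Fin m) j) = r j := by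
  simp [rowDual_apply, Pi.single_apply]

lemma sum_mul_rowDual {A : Type} [CommRing A] {n m : ℕ} (c : Fin n → A) (r : Fin n → Fin m → A)
    (v : Fin m → A) : ∑ i, c i * rowDual (r i) v = ∑ j, (∑ i, c i * r i j) * v j := by
  simp only [rowDual_apply, Finset.mul_sum, Finset.sum_mul]
  rw [Finset.sum_comm]
  simp only [mul_assoc]

open MvPolynomial in
theorem not_minors_le_of_isPrime {k : Type} [Field k] [CharZero k] {n m d t : ℕ}
    (hmd : d + m = n) (hmt : m ≤ t + d) (htm : t + 1 ≤ m)
    {δ : Fin n → ℕ} (hδ : ∀ i, 0 < δ i) {f : Fin m → MvPolynomial (Fin n) k} {e : Fin m → ℕ}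
    (hf : ∀ j, (f j).IsWeightedHomogeneous δ (e j))
    (hreg : RingTheory.Sequence.IsRegular (MvPolynomial (Fin n) k) (List.ofFn f))
    (hm2 : ∀ j, f j ∈ idealOfVars (Fin n) k ^ 2) (σ : Fin (t + 1) → Fin n)
    (J : Ideal (MvPolynomial (Fin n) k))
    (hJ : ∀ (g : Fin (t + 1) → Fin n) (h : Fin (t + 1) → Fin m),
      (Matrix.of fun i j => pderiv (g i) (f (h j))).det ∈ J)
    (hσJ : J ≤ minorsIdeal (fun i j => pderiv (σ i) (f j)) (t + 1) ⊔ Ideal.span (Set.range f))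
    (hprime : ∀ p : Ideal (MvPolynomial (Fin n) k), p.IsPrime → J ≤ p →
      Ideal.span (Set.range f) ≤ p → p ≤ idealOfVars (Fin n) k → p = idealOfVars (Fin n) k) :
    False := by
  let L := Localization.AtPrime (idealOfVars (Fin n) k)
  set F := Ideal.span (Set.range f) with hF
  let loc : MvPolynomial (Fin n) k →+* L := algebraMap _ L
  have : IsNoetherianRing L := IsLocalization.isNoetherianRing (idealOfVars (Fin n) k).primeCompl L
    inferInstance
  have hmem : ∀ j, f j ∈ idealOfVars (Fin n) k := fun j => Ideal.pow_le_self two_ne_zero (hm2 j)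
  have hG : HasGrade ((idealOfVars (Fin n) k).map loc) d (F.map loc) :=
    (hasGrade_span_range hmd hreg hmem).map_localization (idealOfVars (Fin n) k).primeCompl d
  let Θ : Fin n → Module.Dual L (Fin m → L) := fun i => rowDual fun j => loc (pderiv i (f j))
  have hdet : ∀ (g : Fin (t + 1) → Fin n) (h : Fin (t + 1) → Fin m),
      (Matrix.of fun i j => Θ (g i) (Pi.basisFun L (Fin m) (h j))).det =
        loc (Matrix.of fun i j => pderiv (g i) (f (h j))).det := by
    intro g h
    rw [RingHom.map_det]
    congr 1
    ext i j
    exact rowDual_basis _ _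
  have hJmax : J.map loc ≤ maxMinors (fun r => Θ (σ r)) ⊔ F.map loc := by
    refine (Ideal.map_mono hσJ).trans ?_
    rw [Ideal.map_sup]
    refine sup_le_sup_right
      (Ideal.map_le_iff_le_comap.2 (minorsIdeal_le_of_det_mem _ fun g => ?_)) _
    rw [Ideal.mem_comap]
    refine Ideal.subset_span ⟨fun j => Pi.basisFun L (Fin m) (g j), ?_⟩
    exact hdet σ g
  have hK : (idealOfVars (Fin n) k).map loc ≤
      (maxMinors (fun r => Θ (σ r)) ⊔ F.map loc).radical := by
    refine (map_le_radical_map (J := J ⊔ F) fun p hp hJp hpm => hprime p hp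
      (le_sup_left.trans hJp) (le_sup_right.trans hJp) hpm).trans (Ideal.radical_mono ?_)
    rw [Ideal.map_sup]
    exact sup_le hJmax le_sup_right
  have hminor : ∀ (g : Fin (t + 1) → Fin n) (v : Fin (t + 1) → Fin m → L),
      (Matrix.of fun i j => Θ (g i) (v j)).det ∈ maxMinors (fun r => Θ (σ r)) ⊔ F.map loc := by
    intro g v
    refine det_mem_of_basis (Pi.basisFun L (Fin m)) (fun i => Θ (g i)) (fun h => ?_) v
    rw [hdet]
    exact hJmax (Ideal.mem_map_of_mem _ (hJ g h))
  set s := σ 0 with hs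
  let Q : Ideal L := RingHom.ker (localAxisJet k s)
  have hQ : ∀ x, loc x ∈ Q ↔ axisJet k s x = 0 := fun x => by
    rw [RingHom.mem_ker, localAxisJet_algebraMap]
  let c : Fin n → L := fun i => loc (δ i • X i)
  have hc : ∀ v, ∑ i, c i * Θ i v ∈ F.map loc := by
    intro v
    have h1 : ∑ i, c i * Θ i v = ∑ j, loc (e j • f j) * v j := by
      refine (sum_mul_rowDual c (fun i j => loc (pderiv i (f j))) v).trans ?_
      refine Finset.sum_congr rfl fun j _ => congrArg (· * v j) ?_
      rw [← (hf j).sum_weight_X_mul_pderiv, map_sum]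
      refine Finset.sum_congr rfl fun i _ => ?_
      rw [← map_mul, smul_mul_assoc]
    rw [h1]
    refine Ideal.sum_mem _ fun j _ => Ideal.mul_mem_right _ _ (Ideal.mem_map_of_mem _ ?_)
    exact Submodule.smul_of_tower_mem _ _ (Ideal.subset_span ⟨j, rfl⟩)
  have haQ : F.map loc ≤ Q := by
    rw [Ideal.map_le_iff_le_comap, hF, Ideal.span_le]
    rintro _ ⟨j, rfl⟩
    exact (hQ _).2 (axisJet_eq_zero s (hm2 j))
  have hcQ : ∀ i, (∀ r, σ r ≠ i) → c i ∈ Q := by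
    intro i hi
    rw [hQ, map_nsmul, axisJet, aeval_X, if_neg (hi 0).symm, smul_zero]
  let jet : Fin (t + 1) → Fin m → k := fun r j => (axisJet k s (pderiv (σ r) (f j))).snd
  obtain ⟨φ, v, hφv, hφ⟩ := exists_dual_families (fun r => rowDual (jet r))
    (by rw [Module.finrank_fin_fun]; exact htm)
  let ext : k →+* L := loc.comp C
  have hext : ∀ a : k, localAxisJet k s (ext a) = algebraMap k _ a := fun a => by
    rw [RingHom.comp_apply, localAxisJet_algebraMap, ← algebraMap_eq, AlgHom.commutes]
  let φL : Fin (t + 1) → Module.Dual L (Fin m → L) := fun i =>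
    rowDual fun j => ext (φ i (Pi.basisFun k (Fin m) j))
  have hφL : ∀ r, ∃ l : Fin (t + 1) → L, ∀ w, Θ (σ r) w - ∑ i, l i * φL i w ∈ Q := by
    intro r
    obtain ⟨l, hl⟩ := hφ r
    refine ⟨fun i => loc (X s) * ext (l i), fun w => ?_⟩
    rw [RingHom.mem_ker, map_sub, sub_eq_zero]
    simp only [Θ, φL, rowDual_apply, map_sum, map_mul, Finset.mul_sum, hext]
    rw [Finset.sum_comm]
    refine Finset.sum_congr rfl fun j _ => ?_
    have h1 := LinearMap.congr_fun hl (Pi.basisFun k (Fin m) j)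
    rw [rowDual_basis, LinearMap.sum_apply] at h1
    have h2 : localAxisJet k s (loc (pderiv (σ r) (f j))) =
        ∑ i, DualNumber.eps * algebraMap k (DualNumber k) (l i) *
          algebraMap k _ (φ i (Pi.basisFun k (Fin m) j)) := by
      rw [localAxisJet_algebraMap, axisJet_eq_of_mem s (pderiv_mem_idealOfVars (hm2 j) _)]
      change jet r j • _ = _
      rw [h1, Finset.sum_smul]
      refine Finset.sum_congr rfl fun i _ => ?_
      rw [mul_assoc, ← map_mul, Algebra.smul_def, mul_comm, LinearMap.smul_apply, smul_eq_mul]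
    have h3 : localAxisJet k s (loc (X s)) = DualNumber.eps := by
      rw [localAxisJet_algebraMap, axisJet, aeval_X, if_pos rfl]
    rw [h2, h3, Finset.sum_mul]
    refine Finset.sum_congr rfl fun i _ => ?_
    ring
  have hone : (Matrix.of fun i j => φL i (fun q => ext (v j q))).det = 1 := by
    rw [← Matrix.det_one (n := Fin (t + 1))]
    congr 1
    ext i j
    have h1 : φL i (fun q => ext (v j q)) = ext (φ i (v j)) := by
      rw [← (Pi.basisFun k (Fin m)).sum_repr (v j), map_sum, map_sum]
      simp only [φL, rowDual_apply, map_smul, smul_eq_mul, map_mul, Pi.basisFun_repr]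
      refine Finset.sum_congr rfl fun q _ => ?_
      rw [mul_comm]
      congr 2
      simp [Finset.sum_apply, Pi.single_apply]
    rw [Matrix.of_apply, h1, hφv, Matrix.one_apply]
    split_ifs
    · exact map_one _
    · exact map_zero _
  have hfin := mul_det_mem_of_maxMinors (Pi.basisFun L (Fin m)) Θ hK hG hmt hc hminor haQ hcQ φL
    hφL (fun j q => ext (v j q))
  rw [hone, mul_one, hQ, map_nsmul, axisJet, aeval_X, if_pos rfl] at hfin
  have h1 := congrArg TrivSqZeroExt.snd hfin
  rw [TrivSqZeroExt.snd_smul, DualNumber.snd_eps, TrivSqZeroExt.snd_zero, nsmul_eq_mul, mul_one,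
    Nat.cast_eq_zero] at h1
  exact (hδ s).ne' h1

open MvPolynomial in
/-- If the ideal of `t × t` minors of the transposed Jacobian matrix of a graded complete
intersection equals that of its last `t` rows, `t = n - 2d + 1`, then its height is
less than `d`. -/
theorem height_minors_lt (k : Type) [Field k] [CharZero k] (n d : ℕ)
    (hd : 2 ≤ d) (h2d : 2 * d ≤ n)
    (δ : Fin n → ℕ) (hδ : ∀ i, 0 < δ i)
    (f : Fin (n - d) → MvPolynomial (Fin n) k) (e : Fin (n - d) → ℕ)
    (hf : ∀ j, (f j).IsWeightedHomogeneous δ (e j))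
    (hreg : RingTheory.Sequence.IsRegular (MvPolynomial (Fin n) k) (List.ofFn f))
    (hm2 : ∀ j, f j ∈
      (Ideal.span (Set.range (X : Fin n → MvPolynomial (Fin n) k))) ^ 2)
    (hdim : ringKrullDim (MvPolynomial (Fin n) k ⧸ Ideal.span (Set.range f)) = (d : ℕ)) :
    letI R := MvPolynomial (Fin n) k ⧸ Ideal.span (Set.range f)
    letI π := Ideal.Quotient.mk (Ideal.span (Set.range f))
    letI θ : Matrix (Fin n) (Fin (n - d)) R := fun i j => π (pderiv i (f j))
    minorsIdeal θ (n - 2 * d + 1) =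
      minorsIdeal (θ.submatrix
        (fun i : Fin (n - 2 * d + 1) => (⟨n - (n - 2 * d + 1) + (i : ℕ), by omega⟩ : Fin n))
        id) (n - 2 * d + 1) →
    idealHeight (minorsIdeal θ (n - 2 * d + 1)) < (d : ℕ∞) := by
  intro hθ
  by_contra hlt
  rw [not_lt] at hlt
  have hθmap := minorsIdeal_map (Ideal.Quotient.mk (Ideal.span (Set.range f)))
    (fun i j => pderiv i (f j)) (n - 2 * d + 1)
  refine not_minors_le_of_isPrime (n := n) (m := n - d) (d := d) (t := n - 2 * d) (by omega)
    (by omega) (by omega) hδ hf hreg hm2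
    (fun i => ⟨n - (n - 2 * d + 1) + (i : ℕ), by omega⟩)
    (minorsIdeal (fun i j => pderiv i (f j)) (n - 2 * d + 1))
    (fun g h => Ideal.subset_span ⟨g, h, rfl⟩) ?_ ?_
  · intro x hx
    rw [← Ideal.mem_quotient_iff_mem_sup]
    refine (minorsIdeal_map (Ideal.Quotient.mk (Ideal.span (Set.range f)))
      (fun (i : Fin (n - 2 * d + 1)) j =>
        pderiv (⟨n - (n - 2 * d + 1) + (i : ℕ), by omega⟩ : Fin n) (f j))
      (n - 2 * d + 1)).le ?_
    refine hθ.le ?_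
    refine hθmap.ge ?_
    exact Ideal.mem_map_of_mem _ hx
  · intro p hp hJp hFp hpm
    refine eq_of_le_of_le_idealHeight hdim hlt hp isPrime_idealOfVars hpm hFp ?_
    exact hθmap.le.trans (Ideal.map_mono hJp)
end
end

section
/- Let θ' be a t × m matrix over a Noetherian ring R with t ≤ m. Then ht I_t(θ') ≤ m − t + 1; that is, the height of the ideal of maximal minors of θ' is at most m − t + 1. -/
noncomputable section

section RowDependence

open Matrix

variable {t m : ℕ}

theorem Matrix.exists_det_submatrix_ne_zero_of_linearIndependent_row {K : Type*} [Field K]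
    {M : Matrix (Fin t) (Fin m) K} (hM : LinearIndependent K M.row) :
    ∃ g : Fin t → Fin m, (M.submatrix id g).det ≠ 0 := by
  obtain ⟨κ, a, ha, hspan, hli⟩ := exists_linearIndependent' K M.col
  have : Finite κ := Finite.of_injective a ha
  have : Fintype κ := Fintype.ofFinite κ
  have hcard : Fintype.card κ = t := by
    rw [linearIndependent_iff_card_eq_finrank_span.mp hli, Set.finrank, hspan,
      ← M.rank_eq_finrank_span_cols, hM.rank_matrix, Fintype.card_fin]
  let e : Fin t ≃ κ := (Fintype.equivFinOfCardEq hcard).symm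
  refine ⟨a ∘ e, ?_⟩
  have hcol : LinearIndependent K (M.submatrix id (a ∘ e)).col := hli.comp e e.injective
  exact ((Matrix.isUnit_iff_isUnit_det _).mp
    (Matrix.linearIndependent_cols_iff_isUnit.mp hcol)).ne_zero

theorem Matrix.exists_vecMul_eq_zero_iff_forall_det_submatrix {D : Type*} [CommRing D] [IsDomain D]
    (M : Matrix (Fin t) (Fin m) D) :
    (∃ v ≠ 0, v ᵥ* M = 0) ↔
      ∀ (f : Fin t → Fin t) (g : Fin t → Fin m), (M.submatrix f g).det = 0 := by
  constructor
  · rintro ⟨v, hv, hvM⟩ f g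
    have h : (M.submatrix id g).det = 0 :=
      Matrix.exists_vecMul_eq_zero_iff.mp ⟨v, hv, funext fun j ↦ congrFun hvM (g j)⟩
    by_cases hf : Function.Injective f
    · let σ : Equiv.Perm (Fin t) := Equiv.ofBijective f (Finite.injective_iff_bijective.mp hf)
      have := Matrix.det_permute σ (M.submatrix id g)
      rw [h, mul_zero] at this
      exact this
    · obtain ⟨i, j, hij, hne⟩ := Function.not_injective_iff.mp hf
      exact Matrix.det_zero_of_row_eq hne (by ext; simp [hij])
  · intro h
    let K := FractionRing D
    have hdep : ¬ LinearIndependent D M.row := by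
      intro hli
      have hli' : LinearIndependent K (M.map (algebraMap D K)).row := by
        rw [← LinearIndependent.iff_fractionRing D K]
        refine hli.map' ((Algebra.linearMap D K).compLeft (Fin m)) ?_
        rw [LinearMap.ker_eq_bot]
        exact (IsFractionRing.injective D K).comp_left
      obtain ⟨g, hg⟩ := Matrix.exists_det_submatrix_ne_zero_of_linearIndependent_row hli'
      apply hg
      have := congrArg (algebraMap D K) (h id g)
      rwa [RingHom.map_det, map_zero] at this
    obtain ⟨v, hv, i, hi⟩ := Fintype.not_linearIndependent_iff.mp hdep
    refine ⟨v, Function.ne_iff.mpr ⟨i, hi⟩, ?_⟩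
    rw [Matrix.vecMul_eq_sum, ← hv]
    rfl

/-- Pivoting on the entry `(i, j)`: the `2 × 2` minors of `M` containing that entry. -/
def Matrix.pivot {R : Type*} [CommRing R] (M : Matrix (Fin (t + 1)) (Fin (m + 1)) R)
    (i : Fin (t + 1)) (j : Fin (m + 1)) : Matrix (Fin t) (Fin m) R :=
  Matrix.of fun k l ↦ M i j * M (i.succAbove k) (j.succAbove l) -
    M (i.succAbove k) j * M i (j.succAbove l)

theorem Matrix.pivot_map {R S : Type*} [CommRing R] [CommRing S] (φ : R →+* S)
    (M : Matrix (Fin (t + 1)) (Fin (m + 1)) R) (i : Fin (t + 1)) (j : Fin (m + 1)) :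
    (M.pivot i j).map φ = (M.map φ).pivot i j := by
  ext k l
  simp [Matrix.pivot]

theorem Matrix.exists_vecMul_pivot_eq_zero_iff {D : Type*} [CommRing D] [IsDomain D]
    (M : Matrix (Fin (t + 1)) (Fin (m + 1)) D) {i : Fin (t + 1)} {j : Fin (m + 1)}
    (hij : M i j ≠ 0) :
    (∃ v ≠ 0, v ᵥ* M.pivot i j = 0) ↔ ∃ v ≠ 0, v ᵥ* M = 0 := by
  have key (v : Fin t → D) (l : Fin m) : (v ᵥ* M.pivot i j) l =
      M i j * ∑ k, v k * M (i.succAbove k) (j.succAbove l) -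
        (∑ k, v k * M (i.succAbove k) j) * M i (j.succAbove l) := by
    simp only [Matrix.vecMul, dotProduct, Matrix.pivot, Matrix.of_apply, Finset.mul_sum,
      Finset.sum_mul, ← Finset.sum_sub_distrib]
    exact Finset.sum_congr rfl fun k _ ↦ by ring
  constructor
  · rintro ⟨v, hv, hvM⟩
    refine ⟨i.insertNth (-∑ k, v k * M (i.succAbove k) j) (M i j • v), ?_, ?_⟩
    · obtain ⟨k, hk⟩ := Function.ne_iff.mp hv
      refine Function.ne_iff.mpr ⟨i.succAbove k, ?_⟩
      simpa using ⟨hij, hk⟩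
    · ext l
      rw [Matrix.vecMul, dotProduct, Fin.sum_univ_succAbove _ i]
      simp only [Fin.insertNth_apply_same, Fin.insertNth_apply_succAbove, Pi.smul_apply,
        smul_eq_mul, mul_assoc, ← Finset.mul_sum, Pi.zero_apply]
      induction l using Fin.succAboveCases j with
      | x => ring
      | p l =>
        have := (key v l).symm.trans (congrFun hvM l)
        rw [Pi.zero_apply] at this
        linear_combination this
  · rintro ⟨v, hv, hvM⟩
    have hsum (l : Fin (m + 1)) :
        v i * M i l + ∑ k, v (i.succAbove k) * M (i.succAbove k) l = 0 := by
      rw [← Fin.sum_univ_succAbove (fun k ↦ v k * M k l) i]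
      exact congrFun hvM l
    refine ⟨fun k ↦ v (i.succAbove k), fun h0 ↦ hv ?_, ?_⟩
    · have h0' (k) : v (i.succAbove k) = 0 := congrFun h0 k
      have hi : v i = 0 := by simpa [h0', hij] using hsum j
      ext k
      induction k using Fin.succAboveCases i with
      | x => exact hi
      | p k => exact h0' k
    · ext l
      rw [key, Pi.zero_apply]
      linear_combination M i j * hsum (j.succAbove l) - M i (j.succAbove l) * hsum j

end RowDependence

section MinorsIdeal

open Matrix

variable {R : Type} [CommRing R] {t m : ℕ}

theorem minorsIdeal_le_ker_iff {D : Type*} [CommRing D] [IsDomain D]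
    (φ : R →+* D) (M : Matrix (Fin t) (Fin m) R) :
    minorsIdeal M t ≤ RingHom.ker φ ↔ ∃ v ≠ 0, v ᵥ* M.map φ = 0 := by
  have hdet (f : Fin t → Fin t) (g : Fin t → Fin m) :
      ((M.map φ).submatrix f g).det = φ (M.submatrix f g).det := (RingHom.map_det φ _).symm
  simp only [Matrix.exists_vecMul_eq_zero_iff_forall_det_submatrix, hdet, minorsIdeal,
    Ideal.span_le]
  constructor
  · exact fun h f g ↦ h ⟨f, g, rfl⟩
  · rintro h _ ⟨f, g, rfl⟩
    exact h f g

theorem minorsIdeal_le_iff_exists_vecMul (q : Ideal R) [q.IsPrime]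
    (M : Matrix (Fin t) (Fin m) R) :
    minorsIdeal M t ≤ q ↔ ∃ v ≠ 0, v ᵥ* M.map (Ideal.Quotient.mk q) = 0 := by
  rw [← minorsIdeal_le_ker_iff, Ideal.mk_ker]

theorem minorsIdeal_pivot_le_iff (q : Ideal R) [q.IsPrime]
    (M : Matrix (Fin (t + 1)) (Fin (m + 1)) R) {i : Fin (t + 1)} {j : Fin (m + 1)}
    (hij : M i j ∉ q) :
    minorsIdeal (M.pivot i j) t ≤ q ↔ minorsIdeal M (t + 1) ≤ q := by
  rw [minorsIdeal_le_iff_exists_vecMul, minorsIdeal_le_iff_exists_vecMul, Matrix.pivot_map,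
    Matrix.exists_vecMul_pivot_eq_zero_iff]
  rwa [Matrix.map_apply, Ne, Ideal.Quotient.eq_zero_iff_mem]

theorem mem_minimalPrimes_minorsIdeal_pivot {p : Ideal R}
    (M : Matrix (Fin (t + 1)) (Fin (m + 1)) R) {i : Fin (t + 1)} {j : Fin (m + 1)}
    (hij : M i j ∉ p) (hp : p ∈ (minorsIdeal M (t + 1)).minimalPrimes) :
    p ∈ (minorsIdeal (M.pivot i j) t).minimalPrimes := by
  have := hp.isPrime
  refine ⟨⟨hp.isPrime, (minorsIdeal_pivot_le_iff p M hij).mpr hp.le⟩, fun q ⟨hq, hle⟩ hqp ↦ ?_⟩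
  exact hp.2 ⟨hq, (minorsIdeal_pivot_le_iff q M fun h ↦ hij (hqp h)).mp hle⟩ hqp

theorem height_le_of_mem_minimalPrimes_minorsIdeal_one [IsNoetherianRing R] {p : Ideal R}
    (M : Matrix (Fin 1) (Fin m) R) (hp : p ∈ (minorsIdeal M 1).minimalPrimes) :
    p.height ≤ m := by
  classical
  have h : minorsIdeal M 1 = Ideal.span (Finset.univ.image (M 0) : Finset R) := by
    refine congrArg Ideal.span (Set.ext fun x ↦ ?_)
    simp only [Matrix.det_fin_one, Matrix.submatrix_apply, Set.mem_ofPred_eq, Finset.coe_image,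
      Finset.coe_univ, Set.image_univ, Set.mem_range]
    constructor
    · rintro ⟨f, g, rfl⟩
      exact ⟨g 0, by rw [Subsingleton.elim (f 0) 0]⟩
    · rintro ⟨j, rfl⟩
      exact ⟨fun _ ↦ 0, fun _ ↦ j, rfl⟩
  rw [h] at hp
  refine (Ideal.height_le_card_of_mem_minimalPrimes_span_finset hp).trans ?_
  exact_mod_cast Finset.card_image_le.trans_eq (Finset.card_fin m)

end MinorsIdeal

section Polynomial

open Polynomial

variable {R : Type} [CommRing R]

theorem Ideal.comap_C_map_C (p : Ideal R) : (p.map (C : R →+* R[X])).comap C = p := by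
  refine le_antisymm (fun x hx ↦ ?_) Ideal.le_comap_map
  simpa using Ideal.mem_map_C_iff.mp hx 0

theorem Ideal.height_le_height_map_C [IsNoetherianRing R] (p : Ideal R) [p.IsPrime] :
    p.height ≤ (p.map (C : R →+* R[X])).height := by
  have : (p.map (C : R →+* R[X])).LiesOver p := ⟨p.comap_C_map_C.symm⟩
  rw [Ideal.height_eq_height_add_of_liesOver_of_hasGoingDown p (p.map (C : R →+* R[X]))]
  exact le_self_add

theorem Ideal.map_C_lt_comap_constantCoeff (p : Ideal R) [hp : p.IsPrime] :
    p.map (C : R →+* R[X]) < p.comap constantCoeff := by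
  refine SetLike.lt_iff_le_and_exists.mpr ⟨fun f hf ↦ Ideal.mem_map_C_iff.mp hf 0, X, ?_,
    fun h ↦ ?_⟩
  · simp
  · have := Ideal.mem_map_C_iff.mp h 1
    rw [coeff_X_one] at this
    exact hp.ne_top ((Ideal.eq_top_iff_one p).mpr this)

/-- If `p` is minimal over `I`, and the ideal `J ≤ p[X]` specializes to `I` at `X = 0`, then `p[X]`
is minimal over `J`. -/
theorem Ideal.map_C_mem_minimalPrimes [IsNoetherianRing R] {p I : Ideal R} {J : Ideal R[X]}
    (hp : p ∈ I.minimalPrimes) (hJ : J ≤ p.map C) (hIJ : I.map C ≤ J ⊔ Ideal.span {X}) :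
    p.map C ∈ J.minimalPrimes := by
  have := hp.isPrime
  obtain ⟨Q, hQ, hQp⟩ := Ideal.exists_minimalPrimes_le hJ
  have := hQ.isPrime
  have hlt := p.map_C_lt_comap_constantCoeff
  have hN : p.comap constantCoeff ∈ (Q ⊔ Ideal.span {(X : R[X])}).minimalPrimes := by
    refine ⟨⟨inferInstance, sup_le (hQp.trans hlt.le) ?_⟩, fun Q' ⟨hQ', hle⟩ hQ'N f hf ↦ ?_⟩
    · simp [Ideal.span_le]
    · have hX : X ∈ Q' := hle (Ideal.mem_sup_right (Ideal.mem_span_singleton_self X))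
      have hpQ' : p ≤ Q'.comap C := by
        refine hp.2 ⟨inferInstance, Ideal.map_le_iff_le_comap.mp ?_⟩ fun c hc ↦ ?_
        · exact hIJ.trans ((sup_le_sup_right hQ.le _).trans hle)
        · simpa using hQ'N hc
      rw [← divX_mul_X_add f]
      exact Q'.add_mem (Q'.mul_mem_left _ hX) (hpQ' hf)
  have hht := Ideal.map_height_le_one_of_mem_minimalPrimes hN
  have hPprime := Ideal.isPrime_map_quotientMk_of_isPrime hQp
  have := Ideal.isPrime_map_quotientMk_of_isPrime (hQp.trans hlt.le)
  have hcomap {P : Ideal R[X]} (h : Q ≤ P) :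
      (P.map (Ideal.Quotient.mk Q)).comap (Ideal.Quotient.mk Q) = P := by
    rw [Ideal.comap_map_quotientMk, sup_eq_right.mpr h]
  have hlt' : (p.map C).map (Ideal.Quotient.mk Q) <
      (p.comap constantCoeff).map (Ideal.Quotient.mk Q) := by
    refine lt_of_le_of_ne (Ideal.map_mono hlt.le) fun h ↦ hlt.ne ?_
    rw [← hcomap hQp, h, hcomap (hQp.trans hlt.le)]
  have h0 := Ideal.height_le_iff.mp (hht.trans_eq Nat.cast_one.symm) _ hPprime hlt'
  rw [Nat.cast_one, Order.lt_one_iff, Ideal.height_eq_zero_iff_eq_bot,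
    Ideal.map_eq_bot_iff_le_ker, Ideal.mk_ker] at h0
  exact le_antisymm hQp h0 ▸ hQ

end Polynomial

open Polynomial in
theorem height_le_of_mem_minimalPrimes_minorsIdeal {R : Type} [CommRing R] [IsNoetherianRing R]
    {t k : ℕ} (M : Matrix (Fin (t + 1)) (Fin (t + k + 1)) R) {p : Ideal R}
    (hp : p ∈ (minorsIdeal M (t + 1)).minimalPrimes) : p.height ≤ (k + 1 : ℕ) := by
  induction t generalizing R with
  | zero =>
    simpa using height_le_of_mem_minimalPrimes_minorsIdeal_one M hp
  | succ t ih =>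
    have pivot_case {S : Type} [CommRing S] [IsNoetherianRing S]
        (M : Matrix (Fin (t + 1 + 1)) (Fin (t + 1 + k + 1)) S) {p : Ideal S} (i j)
        (hij : M i j ∉ p) (hp : p ∈ (minorsIdeal M (t + 1 + 1)).minimalPrimes) :
        p.height ≤ (k + 1 : ℕ) := by
      have h := mem_minimalPrimes_minorsIdeal_pivot M hij hp
      have e : t + 1 + k = t + k + 1 := by ring
      generalize M.pivot i j = N at h
      revert N
      rw [e]
      exact fun N h ↦ ih N h
    by_cases hM : ∀ i j, M i j ∈ p
    · have := hp.isPrime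
      let N : Matrix (Fin (t + 1 + 1)) (Fin (t + 1 + k + 1)) R[X] :=
        M.map C + Matrix.single 0 0 X
      refine p.height_le_height_map_C.trans
        (pivot_case N 0 0 ?_ (Ideal.map_C_mem_minimalPrimes hp ?_ ?_))
      · intro h
        have := Ideal.mem_map_C_iff.mp h 1
        simp only [N, Matrix.add_apply, Matrix.map_apply, Matrix.single_apply_same, coeff_add,
          coeff_C_succ, coeff_X_one, zero_add] at this
        exact hp.isPrime.ne_top ((Ideal.eq_top_iff_one p).mpr this)
      · rw [minorsIdeal_le_iff_exists_vecMul]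
        refine ⟨Pi.single 1 1, by simp, ?_⟩
        ext j
        simp only [Matrix.single_one_vecMul, Matrix.row_apply, Matrix.map_apply, N,
          Matrix.add_apply, Pi.zero_apply]
        rw [Ideal.Quotient.eq_zero_iff_mem, Matrix.single_apply_of_ne _ _ _ _ _ (by simp), add_zero]
        exact Ideal.mem_map_of_mem C (hM 1 j)
      · rw [minorsIdeal, Ideal.map_span, Ideal.span_le]
        rintro _ ⟨_, ⟨f, g, rfl⟩, rfl⟩
        let φ := Ideal.Quotient.mk (minorsIdeal N (t + 1 + 1) ⊔ Ideal.span {X})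
        have hφ : (M.map C).map φ = N.map φ := by
          have hX : φ X = 0 := Ideal.Quotient.eq_zero_iff_mem.mpr
            (Ideal.mem_sup_right (Ideal.mem_span_singleton_self X))
          ext i j
          by_cases h : 0 = i ∧ 0 = j
          · obtain ⟨rfl, rfl⟩ := h
            simp [N, hX]
          · simp [N, Matrix.single_apply_of_ne _ _ _ _ _ h]
        rw [SetLike.mem_coe, ← Ideal.Quotient.eq_zero_iff_mem]
        change φ _ = 0
        calc φ (C (M.submatrix f g).det) = (((M.map C).map φ).submatrix f g).det := by
              rw [RingHom.map_det, RingHom.map_det]; rfl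
          _ = φ (N.submatrix f g).det := by rw [hφ, RingHom.map_det]; rfl
          _ = 0 := Ideal.Quotient.eq_zero_iff_mem.mpr
              (Ideal.mem_sup_left (Ideal.subset_span ⟨f, g, rfl⟩))
    · push Not at hM
      obtain ⟨i, j, hij⟩ := hM
      exact pivot_case M i j hij hp

/-- Eagon–Northcott bound: the height of the ideal of maximal minors of a `t × m` matrix
(`t ≤ m`) is at most `m - t + 1`. -/
theorem height_maximal_minors_le (R : Type) [CommRing R] [IsNoetherianRing R]
    (t m : ℕ) (h : t ≤ m) (θ : Matrix (Fin t) (Fin m) R)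
    (hne : minorsIdeal θ t ≠ ⊤) :
    idealHeight (minorsIdeal θ t) ≤ ((m - t + 1 : ℕ) : ℕ∞) := by
  obtain ⟨p, hp⟩ := Ideal.nonempty_minimalPrimes hne
  refine (iInf₂_le (⟨p, hp.isPrime⟩ : PrimeSpectrum R) hp.le).trans ?_
  rw [← PrimeSpectrum.height_eq_orderHeight]
  obtain ⟨k, rfl⟩ := Nat.exists_eq_add_of_le h
  rw [Nat.add_sub_cancel_left]
  cases t with
  | zero =>
    refine absurd ((Ideal.eq_top_iff_one _).mpr (Ideal.subset_span ?_)) hne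
    exact ⟨Fin.elim0, Fin.elim0, Matrix.det_isEmpty.symm⟩
  | succ t =>
    have e : t + 1 + k = t + k + 1 := by ring
    revert θ
    rw [e]
    exact fun θ _ hp ↦ height_le_of_mem_minimalPrimes_minorsIdeal θ hp
end
end
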